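/- arXiv:1009.0575 — 2 statements merged into one kernel-verified Lean document; each statement's English description precedes it below -/
import Mathlib

section
/- Any circle decomposition of the annulus A is upper semicontinuous. -/
open Topology Set

/-- A circle in a topological space `X`: a subset homeomorphic to the unit circle. -/
def IsCircle {X : Type*} [TopologicalSpace X] (C : Set X) : Prop :=
  Nonempty (C ≃ₜ Circle)

/-- A circle decomposition of `X`: a set of pairwise disjoint circles whose union is `X`. -/
def IsCircleDecomposition {X : Type*} [TopologicalSpace X] (𝒞 : Set (Set X)) : Prop :=
  (∀ C ∈ 𝒞, IsCircle C) ∧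
  (∀ C ∈ 𝒞, ∀ D ∈ 𝒞, C ≠ D → Disjoint C D) ∧
  ⋃₀ 𝒞 = Set.univ

/-- A decomposition `𝒞` of `X` is upper semicontinuous if for every `C ∈ 𝒞` and every
open `U ⊇ C` there is an open `V ⊇ C` such that every `D ∈ 𝒞` meeting `V` lies in `U`. -/
def IsUpperSemicontinuousDecomposition {X : Type*} [TopologicalSpace X]
    (𝒞 : Set (Set X)) : Prop :=
  ∀ C ∈ 𝒞, ∀ U : Set X, IsOpen U → C ⊆ U →
    ∃ V : Set X, IsOpen V ∧ C ⊆ V ∧ ∀ D ∈ 𝒞, (D ∩ V) ≠ ∅ → D ⊆ U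

theorem exists_int_forall_mem_Icc_of_sin_nonneg {φ : ℝ → ℝ} (hφ : Continuous φ)
    (h : ∀ t, 0 ≤ Real.sin (φ t)) :
    ∃ k : ℤ, ∀ t, 2 * Real.pi * k ≤ φ t ∧ φ t ≤ 2 * Real.pi * k + Real.pi := by
  have hπ := Real.pi_pos
  set k : ℤ := ⌊φ 0 / (2 * Real.pi)⌋ with hk
  have h1 : 2 * Real.pi * k ≤ φ 0 := by
    have := Int.floor_le (φ 0 / (2 * Real.pi))
    rw [le_div_iff₀ (by positivity)] at this
    linarith
  have h2 : φ 0 < 2 * Real.pi * k + 2 * Real.pi := by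
    have := Int.lt_floor_add_one (φ 0 / (2 * Real.pi))
    rw [div_lt_iff₀ (by positivity)] at this
    linarith
  have hcon : (range φ).OrdConnected := (isPreconnected_range hφ).ordConnected
  have hup : 2 * Real.pi * k + 3 * Real.pi / 2 ∉ range φ := by
    rintro ⟨t, ht⟩
    have := h t
    rw [ht, show 2 * Real.pi * k + 3 * Real.pi / 2 = (Real.pi / 2 + Real.pi) + k * (2 * Real.pi)
      by ring, Real.sin_add_int_mul_two_pi, Real.sin_add_pi, Real.sin_pi_div_two] at this
    linarith
  have hdn : 2 * Real.pi * k - Real.pi / 2 ∉ range φ := by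
    rintro ⟨t, ht⟩
    have := h t
    rw [ht, show 2 * Real.pi * k - Real.pi / 2 = -(Real.pi / 2) + k * (2 * Real.pi)
      by ring, Real.sin_add_int_mul_two_pi, Real.sin_neg, Real.sin_pi_div_two] at this
    linarith
  have hlt0 : φ 0 < 2 * Real.pi * k + 3 * Real.pi / 2 := by
    by_contra! hcon'
    have h3 := h 0
    have h4 : Real.sin (φ 0 - Real.pi - k * (2 * Real.pi)) > 0 :=
      Real.sin_pos_of_pos_of_lt_pi (by linarith) (by linarith)
    rw [Real.sin_sub_int_mul_two_pi, Real.sin_sub_pi] at h4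
    linarith
  have hb : ∀ t, 2 * Real.pi * k - Real.pi / 2 < φ t ∧ φ t < 2 * Real.pi * k + 3 * Real.pi / 2 := by
    intro t
    refine ⟨?_, ?_⟩ <;> by_contra! hc
    · exact hdn (hcon.out (mem_range_self t) (mem_range_self 0) ⟨hc, by linarith⟩)
    · exact hup (hcon.out (mem_range_self 0) (mem_range_self t) ⟨by linarith, hc⟩)
  refine ⟨k, fun t => ?_⟩
  obtain ⟨hb1, hb2⟩ := hb t
  have h3 := h t
  refine ⟨?_, ?_⟩ <;> by_contra! hc
  · have h4 : Real.sin (φ t - k * (2 * Real.pi)) < 0 :=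
      Real.sin_neg_of_neg_of_neg_pi_lt (by linarith) (by linarith)
    rw [Real.sin_sub_int_mul_two_pi] at h4
    linarith
  · have h4 : Real.sin (φ t - Real.pi - k * (2 * Real.pi)) > 0 :=
      Real.sin_pos_of_pos_of_lt_pi (by linarith) (by linarith)
    rw [Real.sin_sub_int_mul_two_pi, Real.sin_sub_pi] at h4
    linarith

/-- A planar Poincaré–Miranda theorem. -/
theorem exists_eq_zero_of_boundary_signs {F : ℝ × ℝ → ℂ} (hF : Continuous F)
    (hl : ∀ t, (F (0, t)).re ≤ 0) (hr : ∀ t, 0 ≤ (F (1, t)).re)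
    (hb : ∀ s, 0 ≤ (F (s, 0)).im) (ht : ∀ s, (F (s, 1)).im ≤ 0) : ∃ x, F x = 0 := by
  by_contra! hne
  obtain ⟨g, ⟨-, hg⟩, -⟩ := Complex.isCoveringMap_exp.existsUnique_continuousMap_lifts
    (⟨fun x => ⟨F x, hne x⟩, by fun_prop⟩ : C(ℝ × ℝ, {z : ℂ // z ≠ 0})) (0, 0)
    (Complex.log (F (0, 0))) (Subtype.ext (Complex.exp_log (hne _)))
  have hexp : ∀ x, Complex.exp (g x) = F x := fun x => congrArg Subtype.val (congrFun hg x)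
  have hre : ∀ x, (F x).re = Real.exp (g x).re * Real.cos (g x).im := fun x => by
    rw [← hexp, Complex.exp_re]
  have him : ∀ x, (F x).im = Real.exp (g x).re * Real.sin (g x).im := fun x => by
    rw [← hexp, Complex.exp_im]
  obtain ⟨k₁, h₁⟩ := exists_int_forall_mem_Icc_of_sin_nonneg
    (φ := fun t => (g (0, t)).im - Real.pi / 2) (by fun_prop) (fun t => by
      have := hl t
      rw [hre] at this
      rw [Real.sin_sub_pi_div_two]
      linarith [nonpos_of_mul_nonpos_right this (Real.exp_pos _)])
  obtain ⟨k₂, h₂⟩ := exists_int_forall_mem_Icc_of_sin_nonneg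
    (φ := fun s => (g (s, 1)).im - Real.pi) (by fun_prop) (fun t => by
      have := ht t
      rw [him] at this
      rw [Real.sin_sub_pi]
      linarith [nonpos_of_mul_nonpos_right this (Real.exp_pos _)])
  obtain ⟨k₃, h₃⟩ := exists_int_forall_mem_Icc_of_sin_nonneg
    (φ := fun t => (g (1, t)).im + Real.pi / 2) (by fun_prop) (fun t => by
      have := hr t
      rw [hre] at this
      rw [Real.sin_add_pi_div_two]
      exact nonneg_of_mul_nonneg_right this (Real.exp_pos _))
  obtain ⟨k₄, h₄⟩ := exists_int_forall_mem_Icc_of_sin_nonneg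
    (φ := fun s => (g (s, 0)).im) (by fun_prop) (fun t => by
      have := hb t
      rw [him] at this
      exact nonneg_of_mul_nonneg_right this (Real.exp_pos _))
  have hπ := Real.pi_pos
  have key : ∀ a b : ℤ, 2 * Real.pi * a < 2 * Real.pi * (b + 1 : ℤ) → a ≤ b := fun a b h => by
    have : (a : ℝ) < (b + 1 : ℤ) := lt_of_mul_lt_mul_left h (by positivity)
    exact Int.lt_add_one_iff.1 (by exact_mod_cast this)
  have e₁₂ : k₁ ≤ k₂ := key _ _ (by push_cast; linarith [h₁ 1, h₂ 0])
  have e₂₃ : k₂ ≤ k₃ - 1 := key _ _ (by push_cast; linarith [h₂ 1, h₃ 1])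
  have e₃₄ : k₃ ≤ k₄ := key _ _ (by push_cast; linarith [h₃ 0, h₄ 1])
  have e₄₁ : k₄ ≤ k₁ := key _ _ (by push_cast; linarith [h₄ 0, h₁ 0])
  omega

/-- A path running from left to right meets a path running from bottom to top. -/
theorem JoinedIn.inter_nonempty_of_crossing {S T : Set ℂ} {a b c d : ℂ} (hS : JoinedIn S a b)
    (hT : JoinedIn T c d) (hre : ∀ w ∈ T, a.re ≤ w.re ∧ w.re ≤ b.re)
    (him : ∀ z ∈ S, c.im ≤ z.im ∧ z.im ≤ d.im) : (S ∩ T).Nonempty := by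
  have hSm : ∀ s, hS.somePath.extend s ∈ S := fun s => by
    obtain ⟨x, hx⟩ := hS.somePath.extend_range ▸ mem_range_self s
    exact hx ▸ hS.somePath_mem x
  have hTm : ∀ s, hT.somePath.extend s ∈ T := fun s => by
    obtain ⟨x, hx⟩ := hT.somePath.extend_range ▸ mem_range_self s
    exact hx ▸ hT.somePath_mem x
  obtain ⟨x, hx⟩ := exists_eq_zero_of_boundary_signs
    (F := fun x => hS.somePath.extend x.1 - hT.somePath.extend x.2) (by fun_prop)
    (fun t => by simpa using (hre _ (hTm t)).1) (fun t => by simpa using (hre _ (hTm t)).2)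
    (fun t => by simpa using (him _ (hSm t)).1) (fun t => by simpa using (him _ (hSm t)).2)
  exact ⟨_, hSm x.1, sub_eq_zero.1 hx ▸ hTm x.2⟩

theorem JoinedIn.exists_mem_closure_diff {X : Type*} [TopologicalSpace X] {F O : Set X} {x y : X}
    (h : JoinedIn F x y) (hO : IsOpen O) (hx : x ∈ O) (hy : y ∉ O) :
    ∃ w ∈ closure O \ O, JoinedIn (F ∩ closure O) x w := by
  set γ := h.somePath
  have hcl : IsCompact {t : unitInterval | γ t ∉ O} :=
    (hO.isClosed_compl.preimage γ.continuous).isCompact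
  obtain ⟨t₀, ht₀, hmin⟩ := hcl.exists_isLeast ⟨1, by simpa using hy⟩
  have hlt : ∀ t < t₀, γ t ∈ O := fun t ht => by
    by_contra hc
    exact absurd (hmin hc) (not_le.2 ht)
  have hpos : 0 < t₀ := by
    rw [unitInterval.pos_iff_ne_zero]
    rintro rfl
    exact ht₀ (by simpa using hx)
  have hcl₀ : γ t₀ ∈ closure O := by
    have : t₀ ∈ closure (Iio t₀) := by
      have hne : (Iio t₀).Nonempty := ⟨0, hpos⟩
      rw [closure_Iio' hne]
      exact self_mem_Iic
    exact map_mem_closure γ.continuous this hlt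
  have hsub : ∀ t ≤ t₀, γ t ∈ F ∩ closure O := fun t ht =>
    ⟨h.somePath_mem t, ht.lt_or_eq.elim (fun h => subset_closure (hlt t h)) (fun h => h ▸ hcl₀)⟩
  have hx₀ : γ 0 = x := γ.source
  have hj : JoinedIn (F ∩ closure O) (γ 0) (γ t₀) := ⟨γ.subpath 0 t₀, fun t => by
    have ht : γ.subpath 0 t₀ t ∈ γ '' Icc 0 t₀ :=
      γ.range_subpath_of_le 0 t₀ hpos.le ▸ mem_range_self t
    obtain ⟨s, hs, hst⟩ := ht
    exact hst ▸ hsub s hs.2⟩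
  exact ⟨γ t₀, ⟨hcl₀, ht₀⟩, by rwa [hx₀] at hj⟩

theorem Complex.re_mem_uIcc_of_mem_segment {x y z : ℂ} (h : z ∈ segment ℝ x y) :
    z.re ∈ uIcc x.re y.re := by
  rw [← segment_eq_uIcc]
  exact image_segment ℝ Complex.reLm.toAffineMap x y ▸ mem_image_of_mem Complex.re h

theorem Complex.im_mem_uIcc_of_mem_segment {x y z : ℂ} (h : z ∈ segment ℝ x y) :
    z.im ∈ uIcc x.im y.im := by
  rw [← segment_eq_uIcc]
  exact image_segment ℝ Complex.imLm.toAffineMap x y ▸ mem_image_of_mem Complex.im h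

theorem Complex.joinedIn_of_re_eq {S : Set ℂ} {x y : ℂ} (hxy : x.re = y.re)
    (h : ∀ z : ℂ, z.re = x.re → z.im ∈ uIcc x.im y.im → z ∈ S) : JoinedIn S x y := by
  refine JoinedIn.of_segment_subset fun z hz => h z ?_ (im_mem_uIcc_of_mem_segment hz)
  simpa [← hxy] using re_mem_uIcc_of_mem_segment hz

theorem Complex.joinedIn_of_im_eq {S : Set ℂ} {x y : ℂ} (hxy : x.im = y.im)
    (h : ∀ z : ℂ, z.im = x.im → z.re ∈ uIcc x.re y.re → z ∈ S) : JoinedIn S x y := by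
  refine JoinedIn.of_segment_subset fun z hz => h z ?_ (re_mem_uIcc_of_mem_segment hz)
  simpa [← hxy] using im_mem_uIcc_of_mem_segment hz

theorem joinedIn_top_or_bottom_of_isPreconnected {S : Set ℂ} {z₀ : ℂ} (hS : IsOpen S)
    (hSc : IsPreconnected S) (hz₀ : z₀ ∈ S) (hre : z₀.re = 0) (him : |z₀.im| < 2)
    (hfar : 3 ∈ S) (h1 : 1 ∉ S) (hn1 : -1 ∉ S)
    (hlat : ∀ z : ℂ, |z.re| = 1 → z.im ≠ 0 → z ∈ S) (hver : ∀ z : ℂ, |z.im| = 2 → z ∈ S) :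
    JoinedIn (S ∩ {z | |z.re| ≤ 1}) z₀ ⟨0, 2⟩ ∨ JoinedIn (S ∩ {z | |z.re| ≤ 1}) z₀ ⟨0, -2⟩ := by
  have hj : JoinedIn S z₀ 3 :=
    ((hS.isConnected_iff_isPathConnected).1 ⟨⟨_, hz₀⟩, hSc⟩).joinedIn _ hz₀ _ hfar
  have hO : IsOpen {z : ℂ | |z.re| < 1 ∧ |z.im| < 2} :=
    (isOpen_lt Complex.continuous_re.abs continuous_const).and
      (isOpen_lt Complex.continuous_im.abs continuous_const)
  obtain ⟨w, ⟨hwc, hwO⟩, hw⟩ := hj.exists_mem_closure_diff hO ⟨by simp [hre], him⟩ (by simp)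
  have hcl : closure {z : ℂ | |z.re| < 1 ∧ |z.im| < 2} ⊆ {z : ℂ | |z.re| ≤ 1 ∧ |z.im| ≤ 2} :=
    closure_minimal (fun z hz => ⟨hz.1.le, hz.2.le⟩)
      ((isClosed_le Complex.continuous_re.abs continuous_const).inter
        (isClosed_le Complex.continuous_im.abs continuous_const))
  have hw' : JoinedIn (S ∩ {z | |z.re| ≤ 1}) z₀ w :=
    hw.mono fun z hz => ⟨hz.1, (hcl hz.2).1⟩
  have hwS := hw'.target_mem.1
  obtain ⟨hwr, hwi⟩ := hcl hwc
  have hor : |w.re| = 1 ∨ |w.im| = 2 := by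
    by_contra! hc
    exact hwO ⟨hwr.lt_of_ne hc.1, hwi.lt_of_ne hc.2⟩
  have hne : w.im ≠ 0 := by
    intro h0
    rcases hor with h | h
    · rcases eq_or_eq_neg_of_abs_eq h with h | h
      · exact h1 (by rwa [← show w = 1 from Complex.ext h h0])
      · exact hn1 (by rwa [← show w = -1 from Complex.ext (by simpa using h) (by simpa using h0)])
    · simp [h0] at h
  have hgo : ∀ c : ℝ, |c| = 2 → 0 < c * w.im →
      JoinedIn (S ∩ {z | |z.re| ≤ 1}) z₀ ⟨0, c⟩ := by
    intro c hc hcw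
    refine (hw'.trans (y := w) (z := ⟨w.re, c⟩) ?_).trans ?_
    · refine Complex.joinedIn_of_re_eq rfl fun z hz1 hz2 => ⟨?_, by simpa [hz1] using hwr⟩
      have hz0 : z.im ≠ 0 := by
        rintro h0
        rw [h0] at hz2
        rcases mem_uIcc.1 hz2 with h | h
        · simp only at h; nlinarith
        · simp only at h; nlinarith
      rcases hor with h | h
      · exact hlat z (by rwa [hz1]) hz0
      · have : w.im = c := by
          rcases eq_or_eq_neg_of_abs_eq h with h | h <;>
          rcases eq_or_eq_neg_of_abs_eq hc with h' | h' <;> rw [h, h'] at hcw ⊢ <;> norm_num at hcw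
        have hz3 : z.im = c := by simpa [this] using hz2
        exact hver z (by rwa [hz3])
    · refine Complex.joinedIn_of_im_eq rfl fun z hz1 hz2 => ⟨hver z (by rw [hz1]; exact hc), ?_⟩
      simp only [mem_ofPred_eq]
      have := abs_le.1 hwr
      rw [abs_le]
      rcases mem_uIcc.1 hz2 with h | h
      · simp only at h; constructor <;> linarith
      · simp only at h; constructor <;> linarith
  rcases lt_or_gt_of_ne hne with h | h
  · exact Or.inr (hgo (-2) (by norm_num) (by linarith))
  · exact Or.inl (hgo 2 (by norm_num) (by linarith))

theorem not_isPreconnected_compl_union_of_top_mem {A B : Set ℂ} (hA : IsCompact A)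
    (hB : IsCompact B) (hAp : IsPathConnected A) (hBp : IsPathConnected B)
    (hAo : IsPathConnected (A \ {-1, 1})) (hBo : IsPathConnected (B \ {-1, 1}))
    (hAB : A ∩ B = {-1, 1}) (hre : ∀ z ∈ A ∪ B, |z.re| ≤ 1) (him : ∀ z ∈ A ∪ B, |z.im| < 2)
    (hends : ∀ z ∈ A ∪ B, |z.re| = 1 → z.im = 0) {l : ℂ} (hl : l ∈ A) (hl0 : l.re = 0)
    (hltop : ∀ z ∈ A ∪ B, z.re = 0 → z.im ≤ l.im) : ¬ IsPreconnected (A ∪ B)ᶜ := by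
  intro hconn
  have hne1 : ∀ z : ℂ, z.re = 0 → z ∉ ({-1, 1} : Set ℂ) := by
    rintro z hz (rfl | rfl) <;> simp at hz
  have hnotB : ∀ z ∈ A, z.re = 0 → z ∉ B := fun z hzA hz hzB =>
    hne1 z hz (hAB ▸ ⟨hzA, hzB⟩)
  have h1 : (1 : ℂ) ∈ A ∩ B := hAB ▸ by simp
  have hn1 : (-1 : ℂ) ∈ A ∩ B := hAB ▸ by simp
  have himA : ∀ z ∈ A, -2 < z.im ∧ z.im < 2 := fun z hz => abs_lt.1 (him z (Or.inl hz))
  have himB : ∀ z ∈ B, -2 < z.im ∧ z.im < 2 := fun z hz => abs_lt.1 (him z (Or.inr hz))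
  have hcre : IsClosed {z : ℂ | z.re = 0} := isClosed_eq (by fun_prop) (by fun_prop)
  have crossA : ∀ T : Set ℂ, T ⊆ {z | |z.re| ≤ 1} → Disjoint A T →
      ¬ JoinedIn T ⟨0, -2⟩ ⟨0, 2⟩ := fun T hT hd hj =>
    not_disjoint_iff_nonempty_inter.2 ((hAp.joinedIn _ hn1.1 _ h1.1).inter_nonempty_of_crossing hj
      (fun w hw => by simpa using abs_le.1 (hT hw))
      (fun z hz => by simpa using ⟨(himA z hz).1.le, (himA z hz).2.le⟩)) hd
  have crossB : ∀ T : Set ℂ, T ⊆ {z | |z.re| ≤ 1} → Disjoint B T →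
      ¬ JoinedIn T ⟨0, -2⟩ ⟨0, 2⟩ := fun T hT hd hj =>
    not_disjoint_iff_nonempty_inter.2 ((hBp.joinedIn _ hn1.2 _ h1.2).inter_nonempty_of_crossing hj
      (fun w hw => by simpa using abs_le.1 (hT hw))
      (fun z hz => by simpa using ⟨(himB z hz).1.le, (himB z hz).2.le⟩)) hd
  have hOff : ∀ C : Set ℂ, Disjoint C ({z : ℂ | |z.re| ≤ 1} \ C) := fun C => disjoint_sdiff_right
  obtain ⟨m, ⟨hmA, hm0⟩, hmin⟩ := (hA.inter_right hcre).exists_isMinOn ⟨l, hl, hl0⟩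
    Complex.continuous_im.continuousOn
  have hmin' : ∀ z ∈ A, z.re = 0 → m.im ≤ z.im := fun z hz hz0 => hmin ⟨hz, hz0⟩
  simp only [mem_ofPred_eq] at hm0
  have hnm : JoinedIn ({z : ℂ | |z.re| ≤ 1} \ B) ⟨0, 2⟩ m := by
    refine JoinedIn.trans (y := l) ?_ ?_
    · refine Complex.joinedIn_of_re_eq hl0.symm fun z hz1 hz2 => ⟨by simp_all, fun hzB => ?_⟩
      have hz3 := hltop z (Or.inr hzB) hz1
      rw [uIcc_of_ge (himA l hl).2.le] at hz2
      have : z = l := Complex.ext (hz1.trans hl0.symm) (le_antisymm hz3 hz2.1)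
      exact hnotB l hl hl0 (this ▸ hzB)
    · exact (hAo.joinedIn _ ⟨hl, hne1 l hl0⟩ _ ⟨hmA, hne1 m hm0⟩).mono fun z hz =>
        ⟨hre z (Or.inl hz.1), fun hzB => hz.2 (hAB ▸ ⟨hz.1, hzB⟩)⟩
  have hexp : (B ∩ {z | z.re = 0} ∩ {z | z.im ≤ m.im}).Nonempty := by
    by_contra hc
    refine crossB _ sdiff_subset (hOff B) (hnm.trans ?_).symm
    refine Complex.joinedIn_of_re_eq hm0 fun z hz1 hz2 => ⟨by simp_all, fun hzB => ?_⟩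
    rw [uIcc_of_ge (himA m hmA).1.le] at hz2
    exact hc ⟨z, ⟨hzB, hz1.trans hm0⟩, hz2.2⟩
  obtain ⟨p, ⟨⟨hpB, hp0⟩, hpm⟩, hpmax⟩ := ((hB.inter_right hcre).inter_right
    (isClosed_le Complex.continuous_im continuous_const)).exists_isMaxOn hexp
    Complex.continuous_im.continuousOn
  obtain ⟨q, ⟨hqB, hq0⟩, hqmin⟩ := (hB.inter_right hcre).exists_isMinOn ⟨p, hpB, hp0⟩
    Complex.continuous_im.continuousOn
  simp only [mem_ofPred_eq] at hp0 hq0 hpm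
  have hqp : q.im ≤ p.im := hqmin ⟨hpB, hp0⟩
  have hpm' : p.im < m.im := hpm.lt_of_ne fun h =>
    hnotB m hmA hm0 (Complex.ext (hp0.trans hm0.symm) h ▸ hpB)
  obtain ⟨c, hpc, hcm⟩ := exists_between hpm'
  have hz₀ : ∀ z : ℂ, z.re = 0 → p.im < z.im → z.im < m.im → z ∉ A ∪ B := by
    rintro z hz h h' (hz' | hz')
    · exact absurd (hmin' z hz' hz) (not_le.2 h')
    · exact absurd (hpmax ⟨⟨hz', hz⟩, h'.le⟩ : z.im ≤ p.im) (not_le.2 h)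
  have hmz : JoinedIn ({z : ℂ | |z.re| ≤ 1} \ B) m ⟨0, c⟩ := by
    refine Complex.joinedIn_of_re_eq hm0 fun z hz1 hz2 => ⟨by simp_all, fun hzB => ?_⟩
    rw [uIcc_of_ge hcm.le] at hz2
    exact absurd (hpmax ⟨⟨hzB, hz1.trans hm0⟩, hz2.2⟩ : z.im ≤ p.im)
      (not_le.2 (hpc.trans_le hz2.1))
  have hsz : JoinedIn ({z : ℂ | |z.re| ≤ 1} \ A) ⟨0, -2⟩ ⟨0, c⟩ := by
    refine (JoinedIn.trans (y := q) ?_ ?_).trans (y := p) ?_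
    · refine Complex.joinedIn_of_re_eq hq0.symm fun z hz1 hz2 => ⟨by simp_all, fun hzA => ?_⟩
      rw [uIcc_of_le (himB q hqB).1.le] at hz2
      exact absurd (hmin' z hzA hz1) (not_le.2 (by linarith [hz2.2]))
    · exact (hBo.joinedIn _ ⟨hqB, hne1 q hq0⟩ _ ⟨hpB, hne1 p hp0⟩).mono fun z hz =>
        ⟨hre z (Or.inr hz.1), fun hzA => hz.2 (hAB ▸ ⟨hzA, hz.1⟩)⟩
    · refine Complex.joinedIn_of_re_eq hp0 fun z hz1 hz2 => ⟨by simp_all, fun hzA => ?_⟩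
      rw [uIcc_of_le hpc.le] at hz2
      exact absurd (hmin' z hzA (hz1.trans hp0)) (not_le.2 (by linarith [hz2.2]))
  rcases joinedIn_top_or_bottom_of_isPreconnected (S := (A ∪ B)ᶜ) (z₀ := ⟨0, c⟩)
    (hA.union hB).isClosed.isOpen_compl hconn (hz₀ _ rfl hpc hcm) rfl
    (abs_lt.2 ⟨(himB p hpB).1.trans hpc, hcm.trans (himA m hmA).2⟩)
    (fun h => by have := hre _ h; norm_num at this) (fun h => h (Or.inl h1.1))
    (fun h => h (Or.inl hn1.1)) (fun z hz hz' h => hz' (hends z h hz))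
    (fun z hz h => (him z h).ne hz) with h | h
  · exact crossA _ sdiff_subset (hOff A)
      (hsz.trans (h.mono fun z hz => ⟨hz.2, fun h => hz.1 (Or.inl h)⟩))
  · exact crossB _ sdiff_subset (hOff B)
      ((hnm.trans hmz).trans (h.mono fun z hz => ⟨hz.2, fun h => hz.1 (Or.inr h)⟩)).symm

theorem not_isPreconnected_compl_union {A B : Set ℂ} (hA : IsCompact A)
    (hB : IsCompact B) (hAp : IsPathConnected A) (hBp : IsPathConnected B)
    (hAo : IsPathConnected (A \ {-1, 1})) (hBo : IsPathConnected (B \ {-1, 1}))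
    (hAB : A ∩ B = {-1, 1}) (hre : ∀ z ∈ A ∪ B, |z.re| ≤ 1) (him : ∀ z ∈ A ∪ B, |z.im| < 2)
    (hends : ∀ z ∈ A ∪ B, |z.re| = 1 → z.im = 0) : ¬ IsPreconnected (A ∪ B)ᶜ := by
  have h1 : (1 : ℂ) ∈ A ∩ B := hAB ▸ by simp
  have hn1 : (-1 : ℂ) ∈ A ∩ B := hAB ▸ by simp
  have hcre : IsClosed {z : ℂ | z.re = 0} := isClosed_eq (by fun_prop) (by fun_prop)
  obtain ⟨z, hz, hz0⟩ : (0 : ℝ) ∈ Complex.re '' A :=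
    (hAp.isConnected.isPreconnected.image _ Complex.continuous_re.continuousOn).ordConnected.out
      (mem_image_of_mem _ hn1.1) (mem_image_of_mem _ h1.1) (by simp)
  obtain ⟨l, ⟨hl, hl0⟩, hmax⟩ := ((hA.union hB).inter_right hcre).exists_isMaxOn
    ⟨z, Or.inl hz, hz0⟩ Complex.continuous_im.continuousOn
  rcases hl with hl | hl
  · exact not_isPreconnected_compl_union_of_top_mem hA hB hAp hBp hAo hBo hAB hre him hends hl hl0
      fun z hz hz0 => hmax ⟨hz, hz0⟩
  · rw [union_comm] at hre him hends hmax ⊢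
    exact not_isPreconnected_compl_union_of_top_mem hB hA hBp hAp hBo hAo (by rwa [inter_comm])
      hre him hends hl hl0 fun z hz hz0 => hmax ⟨hz, hz0⟩

theorem Circle.exists_arcs {u v : Circle} (huv : u ≠ v) :
    ∃ P Q : Set Circle, IsCompact P ∧ IsCompact Q ∧ IsPathConnected P ∧ IsPathConnected Q ∧
      IsPathConnected (P \ {u, v}) ∧ IsPathConnected (Q \ {u, v}) ∧ P ∪ Q = univ ∧
      P ∩ Q = {u, v} := by
  have hπ := Real.pi_pos
  obtain ⟨a, b, ha, hb, hab, hba⟩ : ∃ a b : ℝ, Circle.exp a = u ∧ Circle.exp b = v ∧ a < b ∧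
      b < a + 2 * Real.pi := by
    have h1 := Complex.neg_pi_lt_arg (u : ℂ)
    have h2 := Complex.neg_pi_lt_arg (v : ℂ)
    have h3 := Complex.arg_le_pi (u : ℂ)
    have h4 := Complex.arg_le_pi (v : ℂ)
    rcases lt_trichotomy (Complex.arg u) (Complex.arg v) with h | h | h
    · exact ⟨_, _, Circle.exp_arg u, Circle.exp_arg v, h, by linarith⟩
    · exact absurd (by rw [← Circle.exp_arg u, h, Circle.exp_arg]) huv
    · exact ⟨_, Complex.arg v + 2 * Real.pi, Circle.exp_arg u,
        by rw [Circle.exp_add_two_pi, Circle.exp_arg], by linarith, by linarith⟩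
  have hinj : ∀ x ∈ Icc a (a + 2 * Real.pi), ∀ y ∈ Icc a (a + 2 * Real.pi),
      Circle.exp x = Circle.exp y →
      x = y ∨ x = y + 2 * Real.pi ∨ y = x + 2 * Real.pi := by
    intro x hx y hy hxy
    obtain ⟨m, hm⟩ := Circle.exp_eq_exp.1 hxy
    have h1 : (m : ℝ) * (2 * Real.pi) ≤ 1 * (2 * Real.pi) := by linarith [hx.2, hy.1]
    have h2 : (-1) * (2 * Real.pi) ≤ (m : ℝ) * (2 * Real.pi) := by linarith [hx.1, hy.2]
    have h1' : m ≤ 1 := by exact_mod_cast le_of_mul_le_mul_right h1 (by positivity)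
    have h2' : -1 ≤ m := by exact_mod_cast le_of_mul_le_mul_right h2 (by positivity)
    obtain rfl | rfl | rfl : m = -1 ∨ m = 0 ∨ m = 1 := by omega
    · right; right; push_cast at hm; linarith
    · left; simpa using hm
    · right; left; push_cast at hm; linarith
  have hc : Continuous Circle.exp := Circle.exp.continuous
  have hab' : a + 2 * Real.pi ∈ Icc a (a + 2 * Real.pi) := ⟨by linarith, le_rfl⟩
  have hu : ∀ x ∈ Icc a (a + 2 * Real.pi), Circle.exp x = u → x = a ∨ x = a + 2 * Real.pi := by
    intro x hx hxu
    rcases hinj x hx a ⟨le_rfl, by linarith⟩ (hxu.trans ha.symm) with h | h | h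
    · exact Or.inl h
    · exact Or.inr h
    · linarith [hx.1]
  have hv : ∀ x ∈ Icc a (a + 2 * Real.pi), Circle.exp x = v → x = b := by
    intro x hx hxv
    rcases hinj x hx b ⟨hab.le, hba.le⟩ (hxv.trans hb.symm) with h | h | h
    · exact h
    · linarith [hx.2]
    · linarith [hx.1]
  have ha' : Circle.exp (a + 2 * Real.pi) = u := by rw [Circle.exp_add_two_pi, ha]
  have hP : Circle.exp '' Icc a b \ {u, v} = Circle.exp '' Ioo a b := by
    ext z
    constructor
    · rintro ⟨⟨x, hx, rfl⟩, hz⟩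
      exact ⟨x, ⟨hx.1.lt_of_ne fun h => hz (Or.inl ((congrArg _ h.symm).trans ha)),
        hx.2.lt_of_ne fun h => hz (Or.inr ((congrArg _ h).trans hb))⟩, rfl⟩
    · rintro ⟨x, hx, rfl⟩
      refine ⟨⟨x, Ioo_subset_Icc_self hx, rfl⟩, ?_⟩
      have hxI : x ∈ Icc a (a + 2 * Real.pi) := ⟨hx.1.le, by linarith [hx.2]⟩
      rintro (h | h)
      · rcases hu x hxI h with h | h <;> linarith [hx.1, hx.2]
      · linarith [hv x hxI h, hx.2]
  have hQ : Circle.exp '' Icc b (a + 2 * Real.pi) \ {u, v} =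
      Circle.exp '' Ioo b (a + 2 * Real.pi) := by
    ext z
    constructor
    · rintro ⟨⟨x, hx, rfl⟩, hz⟩
      exact ⟨x, ⟨hx.1.lt_of_ne fun h => hz (Or.inr ((congrArg _ h.symm).trans hb)),
        hx.2.lt_of_ne fun h => hz (Or.inl ((congrArg _ h).trans ha'))⟩, rfl⟩
    · rintro ⟨x, hx, rfl⟩
      refine ⟨⟨x, Ioo_subset_Icc_self hx, rfl⟩, ?_⟩
      have hxI : x ∈ Icc a (a + 2 * Real.pi) := ⟨by linarith [hx.1], hx.2.le⟩
      rintro (h | h)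
      · rcases hu x hxI h with h | h <;> linarith [hx.1, hx.2]
      · linarith [hv x hxI h, hx.1]
  refine ⟨Circle.exp '' Icc a b, Circle.exp '' Icc b (a + 2 * Real.pi), isCompact_Icc.image hc,
    isCompact_Icc.image hc, ((convex_Icc _ _).isPathConnected ⟨a, by simp [hab.le]⟩).image hc,
    ((convex_Icc _ _).isPathConnected ⟨b, by simp [hba.le]⟩).image hc, ?_, ?_, ?_, ?_⟩
  · rw [hP]
    exact ((convex_Ioo _ _).isPathConnected (nonempty_Ioo.2 hab)).image hc
  · rw [hQ]
    exact ((convex_Ioo _ _).isPathConnected (nonempty_Ioo.2 hba)).image hc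
  · rw [← image_union, Icc_union_Icc_eq_Icc hab.le hba.le, eq_univ_iff_forall]
    intro z
    obtain ⟨x, hx, hxz⟩ := Circle.periodic_exp.exists_mem_Ico (by positivity)
      (Complex.arg z) a
    exact ⟨x, ⟨hx.1, hx.2.le⟩, by rw [← hxz, Circle.exp_arg]⟩
  · ext z
    constructor
    · rintro ⟨⟨x, hx, rfl⟩, ⟨y, hy, hyx⟩⟩
      rcases hinj y ⟨by linarith [hy.1], hy.2⟩ x ⟨hx.1, by linarith [hx.2]⟩ hyx with h | h | h
      · right
        have : x = b := le_antisymm hx.2 (h ▸ hy.1)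
        rw [this, mem_singleton_iff, hb]
      · left
        have : x = a := by linarith [hx.1, hy.2]
        rw [this, ha]
      · linarith [hx.2, hy.1]
    · rintro (rfl | rfl)
      · exact ⟨⟨a, ⟨le_rfl, hab.le⟩, ha⟩, ⟨_, ⟨hba.le, le_rfl⟩, ha'⟩⟩
      · exact ⟨⟨b, ⟨hab.le, le_rfl⟩, hb⟩, ⟨_, ⟨le_rfl, hba.le⟩, hb⟩⟩

/-- A Jordan curve whose diameter is realised by the points `-1` and `1` separates the plane. -/
theorem not_isPreconnected_compl_range_circle_of_norm_sub_le {γ : Circle → ℂ} (hγ : Continuous γ)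
    (hinj : Function.Injective γ) {u v : Circle} (hu : γ u = -1) (hv : γ v = 1)
    (hd : ∀ x y, ‖γ x - γ y‖ ≤ 2) : ¬ IsPreconnected (range γ)ᶜ := by
  have huv : u ≠ v := by
    rintro rfl
    rw [hu] at hv
    norm_num [Complex.ext_iff] at hv
  obtain ⟨P, Q, hP, hQ, hPp, hQp, hPo, hQo, hPQ, hPQ'⟩ := Circle.exists_arcs huv
  have hU : γ '' P ∪ γ '' Q = range γ := by rw [← image_union, hPQ, image_univ]
  have hI : γ '' {u, v} = {-1, 1} := by rw [image_pair, hu, hv]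
  have hbd : ∀ z ∈ γ '' P ∪ γ '' Q, (z.re - 1) ^ 2 + z.im ^ 2 ≤ 4 ∧
      (z.re + 1) ^ 2 + z.im ^ 2 ≤ 4 := by
    rw [hU]
    rintro _ ⟨x, rfl⟩
    have h1 := hd x v
    have h2 := hd x u
    rw [hv, ← sq_le_sq₀ (norm_nonneg _) (by norm_num), Complex.sq_norm, Complex.normSq_apply] at h1
    rw [hu, ← sq_le_sq₀ (norm_nonneg _) (by norm_num), Complex.sq_norm, Complex.normSq_apply] at h2
    simp at h1 h2
    constructor <;> nlinarith
  rw [← hU]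
  refine not_isPreconnected_compl_union (hP.image hγ) (hQ.image hγ) (hPp.image hγ) (hQp.image hγ)
    ?_ ?_ ?_ (fun z hz => ?_) (fun z hz => ?_) (fun z hz h => ?_)
  · rw [← hI, ← image_sdiff hinj]; exact hPo.image hγ
  · rw [← hI, ← image_sdiff hinj]; exact hQo.image hγ
  · rw [← image_inter hinj, hPQ', hI]
  · obtain ⟨h1, h2⟩ := hbd z hz
    rw [abs_le]; constructor <;> nlinarith
  · obtain ⟨h1, h2⟩ := hbd z hz
    rw [abs_lt]; constructor <;> nlinarith
  · obtain ⟨h1, h2⟩ := hbd z hz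
    rcases eq_or_eq_neg_of_abs_eq h with h | h <;> rw [h] at h1 h2 <;>
    exact pow_eq_zero_iff (two_ne_zero) |>.1 (le_antisymm (by linarith) (sq_nonneg _))

/-- A Jordan curve separates the plane. -/
theorem not_isPreconnected_compl_range_circle {γ : Circle → ℂ} (hγ : Continuous γ)
    (hinj : Function.Injective γ) : ¬ IsPreconnected (range γ)ᶜ := by
  obtain ⟨⟨u, v⟩, -, hmax⟩ := (isCompact_univ (X := Circle × Circle)).exists_isMaxOn univ_nonempty
    (f := fun x => ‖γ x.1 - γ x.2‖) (by fun_prop)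
  have hmax' : ∀ x y, ‖γ x - γ y‖ ≤ ‖γ v - γ u‖ := fun x y => by
    rw [norm_sub_rev (γ v)]; exact hmax (mem_univ (x, y))
  have hne : γ v - γ u ≠ 0 := by
    intro h0
    obtain ⟨x, y, hxy⟩ : ∃ x y : Circle, x ≠ y := ⟨Circle.exp Real.pi, 1, fun h => by
      have := congrArg Subtype.val h
      rw [Circle.coe_exp, Complex.exp_pi_mul_I, Circle.coe_one] at this
      norm_num at this⟩
    have := hmax' x y
    rw [h0, norm_zero, norm_le_zero_iff, sub_eq_zero] at this
    exact hxy (hinj this)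
  set φ : ℂ → ℂ := fun z => (2 * z - γ u - γ v) / (γ v - γ u) with hφ
  have hφc : Continuous φ := by fun_prop
  have hφs : ∀ z w, φ z - φ w = 2 * (z - w) / (γ v - γ u) := fun z w => by
    simp only [hφ]; ring
  have hφi : Function.Injective φ := fun z w h => by
    have := hφs z w
    rw [h, sub_self, eq_comm, div_eq_zero_iff, or_iff_left hne, mul_eq_zero,
      or_iff_right two_ne_zero, sub_eq_zero] at this
    exact this
  have hφr : Function.Surjective φ := fun w => ⟨(w * (γ v - γ u) + γ u + γ v) / 2, by
    simp only [hφ]; field_simp; ring⟩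
  intro hcon
  refine not_isPreconnected_compl_range_circle_of_norm_sub_le (γ := φ ∘ γ) (hφc.comp hγ)
    (hφi.comp hinj) (u := u) (v := v) ?_ ?_ (fun x y => ?_) ?_
  · simp only [hφ, Function.comp]; field_simp; ring
  · simp only [hφ, Function.comp]; field_simp; ring
  · simp only [Function.comp, hφs, norm_div, norm_mul]
    rw [div_le_iff₀ (norm_pos_iff.2 hne)]
    simpa using hmax' x y
  · rw [range_comp, ← image_compl_eq ⟨hφi, hφr⟩]
    exact hcon.image _ hφc.continuousOn

section Separation

variable {X : Type*} [TopologicalSpace X]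

theorem subset_connectedComponentIn_compl_of_inter_nonempty {D E : Set X} {x : X}
    (hE : IsPreconnected E) (hDE : Disjoint D E) (h : (E ∩ connectedComponentIn Dᶜ x).Nonempty) :
    E ⊆ connectedComponentIn Dᶜ x := by
  obtain ⟨z, hzE, hz⟩ := h
  rw [connectedComponentIn_eq hz]
  exact hE.subset_connectedComponentIn hzE hDE.symm.subset_compl_right

theorem isPreconnected_union_connectedComponentIn_compl [LocallyConnectedSpace X]
    [PreconnectedSpace X] {D : Set X} (hD : IsPreconnected D) (hDc : IsClosed D)
    (hDn : D.Nonempty) {x : X} (hx : x ∉ D) :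
    IsPreconnected (D ∪ connectedComponentIn Dᶜ x) := by
  set W := connectedComponentIn Dᶜ x
  have hxW : x ∈ W := mem_connectedComponentIn hx
  have hW : IsPreconnected W := isPreconnected_connectedComponentIn
  have hne : (closure W ∩ D).Nonempty := by
    by_contra hc
    have hcl : closure W ⊆ W := hW.closure.subset_connectedComponentIn (subset_closure hxW)
      fun z hz hzD => hc ⟨z, hz, hzD⟩
    have huniv : W = univ := IsClopen.eq_univ
      ⟨isClosed_of_closure_subset hcl, hDc.isOpen_compl.connectedComponentIn⟩ ⟨x, hxW⟩
    obtain ⟨d, hd⟩ := hDn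
    exact connectedComponentIn_subset Dᶜ x (huniv ▸ mem_univ d : d ∈ W) hd
  obtain ⟨z, hzW, hzD⟩ := hne
  have h1 : IsPreconnected (insert z W) :=
    hW.subset_closure (subset_insert _ _) (insert_subset hzW subset_closure)
  have h2 := IsPreconnected.union z hzD (mem_insert z W) hD h1
  rwa [union_insert, insert_eq_of_mem (mem_union_left _ hzD)] at h2

theorem union_connectedComponentIn_compl_subset [LocallyConnectedSpace X]
    [PreconnectedSpace X] {D E : Set X} (hD : IsPreconnected D) (hDc : IsClosed D)
    (hDn : D.Nonempty) {x : X} (hx : x ∉ D) (hDE : Disjoint D E)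
    (h : Disjoint E (connectedComponentIn Dᶜ x)) :
    D ∪ connectedComponentIn Dᶜ x ⊆ connectedComponentIn Eᶜ x :=
  (isPreconnected_union_connectedComponentIn_compl hD hDc hDn hx).subset_connectedComponentIn
    (Or.inr (mem_connectedComponentIn hx))
    (union_subset hDE.subset_compl_right h.symm.subset_compl_right)

theorem disjoint_connectedComponentIn {F : Set X} {x y : X} (h : y ∉ connectedComponentIn F x) :
    Disjoint (connectedComponentIn F x) (connectedComponentIn F y) := by
  rw [disjoint_left]
  intro z hz hz'
  rw [connectedComponentIn_eq hz, ← connectedComponentIn_eq hz'] at h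
  exact h (mem_connectedComponentIn
    (connectedComponentIn_nonempty_iff.1 ⟨z, hz'⟩))

theorem subset_connectedComponentIn_compl_or [LocallyConnectedSpace X] [PreconnectedSpace X]
    {D E : Set X} {x y : X} (hD : IsConnected D) (hE : IsConnected E) (hDc : IsClosed D)
    (hDE : Disjoint D E) (hx : x ∉ D) (hy : y ∉ D) (hsep : y ∉ connectedComponentIn Eᶜ x) :
    E ⊆ connectedComponentIn Dᶜ x ∨ E ⊆ connectedComponentIn Dᶜ y := by
  by_contra! hc
  have h : ∀ z, z ∉ D → ¬ E ⊆ connectedComponentIn Dᶜ z → D ⊆ connectedComponentIn Eᶜ z := by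
    intro z hz hEz
    refine subset_union_left.trans (union_connectedComponentIn_compl_subset hD.isPreconnected hDc
      hD.nonempty hz hDE (not_not.1 fun h => hEz ?_))
    exact subset_connectedComponentIn_compl_of_inter_nonempty hE.isPreconnected hDE
      (not_disjoint_iff_nonempty_inter.1 h)
  obtain ⟨d, hd⟩ := hD.nonempty
  exact disjoint_left.1 (disjoint_connectedComponentIn hsep) (h x hx hc.1 hd) (h y hy hc.2 hd)

/-- The conclusion of upper semicontinuity at `C`, restricted to the members lying in the
component of `Cᶜ` containing `x`. -/
theorem exists_isOpen_forall_subset_of_subset_connectedComponentIn [LocallyConnectedSpace X]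
    [PreconnectedSpace X] {𝒟 : Set (Set X)} {K : Set X} {x y : X}
    (hK : IsCompact K) (hcov : ⋃₀ 𝒟 = K) (hconn : ∀ D ∈ 𝒟, IsConnected D)
    (hcl : ∀ D ∈ 𝒟, IsClosed D) (hdisj : ∀ D ∈ 𝒟, ∀ E ∈ 𝒟, D ≠ E → Disjoint D E)
    (hx : x ∉ K) (hy : y ∉ K) (hsep : ∀ D ∈ 𝒟, y ∉ connectedComponentIn Dᶜ x)
    {C U : Set X} (hC : C ∈ 𝒟) (hU : IsOpen U) (hCU : C ⊆ U) :
    ∃ V, IsOpen V ∧ C ⊆ V ∧ ∀ D ∈ 𝒟, D ⊆ connectedComponentIn Cᶜ x → (D ∩ V).Nonempty →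
      D ⊆ U := by
  have hsub : ∀ D ∈ 𝒟, D ⊆ K := fun D hD => hcov ▸ subset_sUnion_of_mem hD
  have hopen : ∀ D ∈ 𝒟, ∀ z, IsOpen (connectedComponentIn Dᶜ z) := fun D hD z =>
    (hcl D hD).isOpen_compl.connectedComponentIn
  have hsides : ∀ D ∈ 𝒟, Disjoint (connectedComponentIn Dᶜ x) (connectedComponentIn Dᶜ y) :=
    fun D hD => disjoint_connectedComponentIn (hsep D hD)
  have hdich : ∀ D ∈ 𝒟, ∀ E ∈ 𝒟, D ≠ E →
      E ⊆ connectedComponentIn Dᶜ x ∨ E ⊆ connectedComponentIn Dᶜ y := fun D hD E hE hne =>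
    subset_connectedComponentIn_compl_or (hconn D hD) (hconn E hE) (hcl D hD)
      (hdisj D hD E hE hne) (fun h => hx (hsub D hD h)) (fun h => hy (hsub D hD h)) (hsep E hE)
  have hne : ∀ D E : Set X, D ∈ 𝒟 → E ⊆ connectedComponentIn Dᶜ x → E.Nonempty → D ≠ E := by
    rintro D _ - h ⟨z, hz⟩ rfl
    exact connectedComponentIn_subset _ _ (h hz) hz
  have hflip : ∀ D ∈ 𝒟, ∀ E ∈ 𝒟, E ⊆ connectedComponentIn Dᶜ x →
      D ∪ connectedComponentIn Dᶜ y ⊆ connectedComponentIn Eᶜ y := fun D hD E hE h =>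
    union_connectedComponentIn_compl_subset (hconn D hD).isPreconnected (hcl D hD)
      (hconn D hD).nonempty (fun h => hy (hsub D hD h))
      (hdisj D hD E hE (hne D E hD h (hconn E hE).nonempty)) ((hsides D hD).mono_left h)
  have hflip' : ∀ D ∈ 𝒟, ∀ E ∈ 𝒟, E ⊆ connectedComponentIn Dᶜ y →
      D ∪ connectedComponentIn Dᶜ x ⊆ connectedComponentIn Eᶜ x := fun D hD E hE h =>
    union_connectedComponentIn_compl_subset (hconn D hD).isPreconnected (hcl D hD)
      (hconn D hD).nonempty (fun h => hx (hsub D hD h))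
      (disjoint_right.2 fun _ hz => connectedComponentIn_subset _ _ (h hz))
      ((hsides D hD).symm.mono_left h)
  by_cases hmax : ∃ D ∈ 𝒟, D ⊆ connectedComponentIn Cᶜ x ∧
      ∀ E ∈ 𝒟, E ⊆ connectedComponentIn Cᶜ x → ¬ D ⊆ connectedComponentIn Eᶜ x
  · obtain ⟨D, hD, hDC, hDmax⟩ := hmax
    refine ⟨connectedComponentIn Dᶜ y, hopen D hD y,
      subset_union_left.trans (hflip C hC D hD hDC), fun E hE hEC ⟨z, hzE, hz⟩ => ?_⟩
    have hDE : D ≠ E := by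
      rintro rfl
      exact connectedComponentIn_subset _ _ hz hzE
    refine absurd (subset_union_left.trans (hflip' D hD E hE ?_)) (hDmax E hE hEC)
    exact subset_connectedComponentIn_compl_of_inter_nonempty (hconn E hE).isPreconnected
      (hdisj D hD E hE hDE) ⟨z, hzE, hz⟩
  push Not at hmax
  by_cases hemp : ∃ D ∈ 𝒟, D ⊆ connectedComponentIn Cᶜ x
  swap
  · exact ⟨univ, isOpen_univ, subset_univ _, fun D hD h => absurd ⟨D, hD, h⟩ hemp⟩
  obtain ⟨D₀, hD₀, hD₀C⟩ := hemp
  set ι := {D : Set X // D ∈ 𝒟 ∧ D ⊆ connectedComponentIn Cᶜ x}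
  have : Nonempty ι := ⟨⟨D₀, hD₀, hD₀C⟩⟩
  have hL : IsCompact (K \ (U ∪ connectedComponentIn Cᶜ y)) :=
    hK.diff (hU.union (hopen C hC y))
  obtain ⟨⟨E, hE, hEC⟩, hLE⟩ := hL.elim_directed_cover
    (fun D : ι => connectedComponentIn (D : Set X)ᶜ x) (fun D => hopen _ D.2.1 x) (by
      rintro z ⟨hzK, hz⟩
      rw [← hcov] at hzK
      obtain ⟨D, hD, hzD⟩ := hzK
      have hCD : C ≠ D := by
        rintro rfl
        exact hz (Or.inl (hCU hzD))
      have hDC : D ⊆ connectedComponentIn Cᶜ x := (hdich C hC D hD hCD).resolve_right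
        fun h => hz (Or.inr (h hzD))
      obtain ⟨E, hE, hEC, hDE⟩ := hmax D hD hDC
      exact mem_iUnion.2 ⟨⟨E, hE, hEC⟩, hDE hzD⟩) (by
      rintro ⟨D, hD, hDC⟩ ⟨E, hE, hEC⟩
      by_cases hDE : D = E
      · subst hDE
        exact ⟨⟨D, hD, hDC⟩, Subset.rfl, Subset.rfl⟩
      rcases hdich D hD E hE hDE with h | h
      · have h' : D ⊆ connectedComponentIn Eᶜ y := subset_union_left.trans (hflip D hD E hE h)
        exact ⟨⟨D, hD, hDC⟩, Subset.rfl, subset_union_right.trans (hflip' E hE D hD h')⟩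
      · exact ⟨⟨E, hE, hEC⟩, subset_union_right.trans (hflip' D hD E hE h), Subset.rfl⟩)
  refine ⟨connectedComponentIn Eᶜ y, hopen E hE y,
    subset_union_left.trans (hflip C hC E hE hEC), fun D hD hDC ⟨z, hzD, hz⟩ w hw => ?_⟩
  have hED : E ≠ D := by
    rintro rfl
    exact connectedComponentIn_subset _ _ hz hzD
  have hDE : D ⊆ connectedComponentIn Eᶜ y :=
    subset_connectedComponentIn_compl_of_inter_nonempty (hconn D hD).isPreconnected
      (hdisj E hE D hD hED) ⟨z, hzD, hz⟩
  by_contra hwU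
  refine disjoint_left.1 (hsides E hE) (hLE ⟨hsub D hD hw, ?_⟩) (hDE hw)
  rintro (h | h)
  · exact hwU h
  · exact disjoint_left.1 (hsides C hC) (hDC hw) h

theorem exists_isOpen_forall_subset_of_separating [LocallyConnectedSpace X]
    [PreconnectedSpace X] {𝒟 : Set (Set X)} {K : Set X} {x y : X}
    (hK : IsCompact K) (hcov : ⋃₀ 𝒟 = K) (hconn : ∀ D ∈ 𝒟, IsConnected D)
    (hcl : ∀ D ∈ 𝒟, IsClosed D) (hdisj : ∀ D ∈ 𝒟, ∀ E ∈ 𝒟, D ≠ E → Disjoint D E)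
    (hx : x ∉ K) (hy : y ∉ K) (hsep : ∀ D ∈ 𝒟, y ∉ connectedComponentIn Dᶜ x)
    {C U : Set X} (hC : C ∈ 𝒟) (hU : IsOpen U) (hCU : C ⊆ U) :
    ∃ V, IsOpen V ∧ C ⊆ V ∧ ∀ D ∈ 𝒟, (D ∩ V).Nonempty → D ⊆ U := by
  have hsub : ∀ D ∈ 𝒟, D ⊆ K := fun D hD => hcov ▸ subset_sUnion_of_mem hD
  have hsep' : ∀ D ∈ 𝒟, x ∉ connectedComponentIn Dᶜ y := fun D hD h =>
    disjoint_left.1 (disjoint_connectedComponentIn (hsep D hD))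
      (mem_connectedComponentIn fun h => hx (hsub D hD h)) h
  obtain ⟨V, hV, hCV, hVU⟩ := exists_isOpen_forall_subset_of_subset_connectedComponentIn
    hK hcov hconn hcl hdisj hx hy hsep hC hU hCU
  obtain ⟨W, hW, hCW, hWU⟩ := exists_isOpen_forall_subset_of_subset_connectedComponentIn
    hK hcov hconn hcl hdisj hy hx hsep' hC hU hCU
  refine ⟨V ∩ W, hV.inter hW, subset_inter hCV hCW, fun D hD hDV => ?_⟩
  by_cases hCD : C = D
  · exact hCD ▸ hCU
  rcases subset_connectedComponentIn_compl_or (hconn C hC) (hconn D hD) (hcl C hC)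
    (hdisj C hC D hD hCD) (fun h => hx (hsub C hC h)) (fun h => hy (hsub C hC h)) (hsep D hD)
    with h | h
  · exact hVU D hD h (hDV.mono (inter_subset_inter_right _ inter_subset_left))
  · exact hWU D hD h (hDV.mono (inter_subset_inter_right _ inter_subset_right))

end Separation

/-- If a compact set `K` whose complement is covered by the components of `x` and `y` is
partitioned into Jordan curves, then each of these curves separates `x` from `y`. -/
theorem notMem_connectedComponentIn_compl_of_partition {𝒟 : Set (Set ℂ)} {K : Set ℂ} {x y : ℂ}
    (hK : IsCompact K) (hcov : ⋃₀ 𝒟 = K)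
    (hcirc : ∀ D ∈ 𝒟, ∃ γ : Circle → ℂ, Continuous γ ∧ Function.Injective γ ∧ range γ = D)
    (hdisj : ∀ D ∈ 𝒟, ∀ E ∈ 𝒟, D ≠ E → Disjoint D E) (hx : x ∉ K)
    (hKc : Kᶜ ⊆ connectedComponentIn Kᶜ x ∪ connectedComponentIn Kᶜ y)
    {D : Set ℂ} (hD : D ∈ 𝒟) : y ∉ connectedComponentIn Dᶜ x := by
  intro hyD
  have hsub : ∀ D ∈ 𝒟, D ⊆ K := fun D hD => hcov ▸ subset_sUnion_of_mem hD
  have hcpt : ∀ D ∈ 𝒟, IsCompact D := fun D hD => by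
    obtain ⟨γ, hγ, -, rfl⟩ := hcirc D hD
    exact isCompact_range hγ
  have hconn : ∀ D ∈ 𝒟, IsConnected D := fun D hD => by
    obtain ⟨γ, hγ, -, rfl⟩ := hcirc D hD
    exact isConnected_range hγ
  set fill : Set ℂ → Set ℂ := fun D => (connectedComponentIn Dᶜ x)ᶜ with hfill
  have hDfill : ∀ D, D ⊆ fill D := fun D z hz hz' => connectedComponentIn_subset _ _ hz' hz
  have hfcl : ∀ D ∈ 𝒟, IsClosed (fill D) := fun D hD =>
    ((hcpt D hD).isClosed.isOpen_compl.connectedComponentIn).isClosed_compl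
  have hfK : ∀ D ∈ 𝒟, y ∈ connectedComponentIn Dᶜ x → fill D ⊆ K := fun D hD hyD z hz => by
    by_contra hzK
    have hmono := fun w => connectedComponentIn_mono w (compl_subset_compl.2 (hsub D hD))
    rcases hKc hzK with h | h
    · exact hz (hmono x h)
    · exact hz (connectedComponentIn_eq hyD ▸ hmono y h)
  have hstep : ∀ D ∈ 𝒟, ∀ E ∈ 𝒟, D ≠ E → (E ∩ fill D).Nonempty →
      D ∪ connectedComponentIn Dᶜ x ⊆ connectedComponentIn Eᶜ x := by
    rintro D hD E hE hne ⟨z, hzE, hz⟩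
    refine union_connectedComponentIn_compl_subset (hconn D hD).isPreconnected
      (hcpt D hD).isClosed (hconn D hD).nonempty (fun h => hx (hsub D hD h))
      (hdisj D hD E hE hne) (not_not.1 fun h => hz ?_)
    exact subset_connectedComponentIn_compl_of_inter_nonempty (hconn E hE).isPreconnected
      (hdisj D hD E hE hne) (not_disjoint_iff_nonempty_inter.1 h) hzE
  obtain ⟨-, -, ⟨M, ⟨hM, hyM⟩, rfl⟩, hmin⟩ := zorn_superset_nonempty
    (fill '' {D | D ∈ 𝒟 ∧ y ∈ connectedComponentIn Dᶜ x}) (by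
      intro c hc hchain hne
      have hne' : Nonempty c := hne.to_subtype
      obtain ⟨z, hz⟩ := IsCompact.nonempty_sInter_of_directed_nonempty_isCompact_isClosed
        (S := c) (fun U hU V hV => (hchain.total hU hV).elim
          (fun h => ⟨U, hU, Subset.rfl, h⟩) (fun h => ⟨V, hV, h, Subset.rfl⟩))
        (fun U hU => by
          obtain ⟨D, hD, rfl⟩ := hc hU
          exact (hconn D hD.1).nonempty.mono (hDfill D))
        (fun U hU => by
          obtain ⟨D, hD, rfl⟩ := hc hU
          exact hK.of_isClosed_subset (hfcl D hD.1) (hfK D hD.1 hD.2))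
        (fun U hU => by
          obtain ⟨D, hD, rfl⟩ := hc hU
          exact hfcl D hD.1)
      have hle : ∀ E ∈ 𝒟, z ∈ E → ∀ U ∈ c, fill E ⊆ U ∧ y ∈ connectedComponentIn Eᶜ x := by
        intro E hE hzE U hU
        obtain ⟨D, hD, rfl⟩ := hc hU
        by_cases hDE : D = E
        · exact hDE ▸ ⟨Subset.rfl, hD.2⟩
        have := subset_union_right.trans (hstep D hD.1 E hE hDE ⟨z, hzE, hz _ hU⟩)
        exact ⟨compl_subset_compl.2 this, this hD.2⟩
      obtain ⟨U, hU⟩ := hne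
      have hzK : z ∈ K := by
        obtain ⟨D, hD, rfl⟩ := hc hU
        exact hfK D hD.1 hD.2 (hz _ hU)
      rw [← hcov] at hzK
      obtain ⟨E, hE, hzE⟩ := hzK
      exact ⟨fill E, ⟨E, ⟨hE, (hle E hE hzE U hU).2⟩, rfl⟩, fun U hU => (hle E hE hzE U hU).1⟩)
    (fill D) ⟨D, ⟨hD, hyD⟩, rfl⟩
  have hfM : fill M = M := by
    refine Subset.antisymm (fun z hz => ?_) (hDfill M)
    have hzK := hfK M hM hyM hz
    rw [← hcov] at hzK
    obtain ⟨E, hE, hzE⟩ := hzK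
    by_contra hzM
    have hME : M ≠ E := by
      rintro rfl
      exact hzM hzE
    have h := hstep M hM E hE hME ⟨z, hzE, hz⟩
    have h' : fill M ⊆ fill E := hmin ⟨E, ⟨hE, h (Or.inr hyM)⟩, rfl⟩
      (compl_subset_compl.2 (subset_union_right.trans h))
    obtain ⟨d, hd⟩ := (hconn M hM).nonempty
    exact h' (hDfill M hd) (h (Or.inl hd))
  obtain ⟨γ, hγ, hinj, rfl⟩ := hcirc M hM
  refine not_isPreconnected_compl_range_circle hγ hinj ?_
  rw [← hfM, hfill, compl_compl]
  exact isPreconnected_connectedComponentIn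

theorem isPreconnected_setOf_lt_norm {E : Type*} [NormedAddCommGroup E] [NormedSpace ℝ E]
    (h : 1 < Module.rank ℝ E) {r : ℝ} (hr : 0 ≤ r) : IsPreconnected {z : E | r < ‖z‖} := by
  have h1 : {z : E | r < ‖z‖} =
      (fun x : ℝ × E => x.1 • x.2) '' (Ioi r ×ˢ Metric.sphere (0 : E) 1) := by
    ext z
    constructor
    · intro hz
      have hz0 : ‖z‖ ≠ 0 := (hr.trans_lt hz).ne'
      exact ⟨(‖z‖, ‖z‖⁻¹ • z), ⟨hz, by simp [norm_smul, hz0]⟩, by simp [smul_smul, hz0]⟩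
    · rintro ⟨⟨t, w⟩, ⟨ht, hw⟩, rfl⟩
      have ht' : r < t := ht
      simp only [mem_sphere_zero_iff_norm] at hw
      simpa [norm_smul, hw, abs_of_pos (hr.trans_lt ht')] using ht'
  rw [h1]
  exact (isPreconnected_Ioi.prod (isPreconnected_sphere h _ _)).image _ (by fun_prop)

theorem norm_one_add_coe_Icc (t : Icc (0 : ℝ) 1) : ‖(1 + (t : ℝ) : ℂ)‖ = 1 + t := by
  rw [← Complex.ofReal_one, ← Complex.ofReal_add, Complex.norm_real, Real.norm_of_nonneg]
  linarith [t.2.1]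

theorem mem_range_one_add_mul_circle {z : ℂ} : z ∈ range
    (fun p : Circle × Icc (0 : ℝ) 1 => (1 + (p.2 : ℝ) : ℂ) * p.1) ↔ 1 ≤ ‖z‖ ∧ ‖z‖ ≤ 2 := by
  constructor
  · rintro ⟨⟨w, t⟩, rfl⟩
    simp only [norm_mul, norm_one_add_coe_Icc, Circle.norm_coe, mul_one]
    constructor <;> linarith [t.2.1, t.2.2]
  · rintro ⟨h1, h2⟩
    refine ⟨(Circle.exp (Complex.arg z), ⟨‖z‖ - 1, by linarith, by linarith⟩), ?_⟩
    simp [Complex.norm_mul_exp_arg_mul_I]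

theorem injective_one_add_mul_circle : Function.Injective
    (fun p : Circle × Icc (0 : ℝ) 1 => (1 + (p.2 : ℝ) : ℂ) * p.1) := by
  rintro ⟨w, t⟩ ⟨w', t'⟩ h
  simp only at h
  have hn := congrArg norm h
  simp only [norm_mul, norm_one_add_coe_Icc, Circle.norm_coe, mul_one] at hn
  have ht : t = t' := Subtype.ext (by linarith)
  subst ht
  have h0 : (1 + (t : ℝ) : ℂ) ≠ 0 := norm_pos_iff.1 (by
    rw [norm_one_add_coe_Icc]; linarith [t.2.1])
  rw [Circle.ext (mul_left_cancel₀ h0 h)]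

theorem IsCircle.exists_range_eq_image {X Y : Type*} [TopologicalSpace X] [TopologicalSpace Y]
    {C : Set X} (hC : IsCircle C) {f : X → Y} (hf : Continuous f) (hfi : Function.Injective f) :
    ∃ γ : Circle → Y, Continuous γ ∧ Function.Injective γ ∧ range γ = f '' C := by
  obtain ⟨e⟩ := hC
  refine ⟨fun z => f (e.symm z), by fun_prop,
    hfi.comp (Subtype.val_injective.comp e.symm.injective), ?_⟩
  rw [show (fun z => f (e.symm z)) = (f ∘ Subtype.val) ∘ e.symm from rfl,
    e.symm.surjective.range_comp, range_comp, Subtype.range_coe]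

/-- Any circle decomposition of the annulus `Circle × [0,1]` is upper semicontinuous. -/
theorem circle_decomposition_annulus_usc
    (𝒞 : Set (Set (Circle × Set.Icc (0:ℝ) 1))) (h𝒞 : IsCircleDecomposition 𝒞) :
    IsUpperSemicontinuousDecomposition 𝒞 := by
  obtain ⟨hcirc, hdisj, hcov⟩ := h𝒞
  intro C hC U hU hCU
  set f : Circle × Icc (0 : ℝ) 1 → ℂ := fun p => (1 + (p.2 : ℝ) : ℂ) * p.1
  have hf : Continuous f := by fun_prop
  have hfi : Function.Injective f := injective_one_add_mul_circle
  have hemb : IsEmbedding f := (hf.isClosedEmbedding hfi).isEmbedding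
  have hK : IsCompact (range f) := isCompact_range hf
  have hmem : ∀ z, z ∈ range f ↔ 1 ≤ ‖z‖ ∧ ‖z‖ ≤ 2 := fun z => mem_range_one_add_mul_circle
  have h0 : (0 : ℂ) ∉ range f := fun h => by have := ((hmem _).1 h).1; norm_num at this
  have h3 : (3 : ℂ) ∉ range f := fun h => by have := ((hmem _).1 h).2; norm_num at this
  have hcov' : ⋃₀ (image f '' 𝒞) = range f := by
    rw [← image_sUnion, hcov, image_univ]
  have hcirc' : ∀ D ∈ image f '' 𝒞,
      ∃ γ : Circle → ℂ, Continuous γ ∧ Function.Injective γ ∧ range γ = D := by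
    rintro _ ⟨D, hD, rfl⟩
    exact (hcirc D hD).exists_range_eq_image hf hfi
  have hdisj' : ∀ D ∈ image f '' 𝒞, ∀ E ∈ image f '' 𝒞, D ≠ E → Disjoint D E := by
    rintro _ ⟨D, hD, rfl⟩ _ ⟨E, hE, rfl⟩ hne
    exact (disjoint_image_iff hfi).2 (hdisj D hD E hE fun h => hne (h ▸ rfl))
  have hKc : (range f)ᶜ ⊆
      connectedComponentIn (range f)ᶜ 0 ∪ connectedComponentIn (range f)ᶜ 3 := by
    intro z hz
    rw [mem_compl_iff, hmem, not_and_or, not_le, not_le] at hz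
    rcases hz with hz | hz
    · have hsub : Metric.ball (0 : ℂ) 1 ⊆ (range f)ᶜ := fun w hw h =>
        absurd ((hmem w).1 h).1 (not_le.2 (by simpa using hw))
      exact Or.inl ((convex_ball (0 : ℂ) 1).isPreconnected.subset_connectedComponentIn
        (by simp) hsub (by simpa using hz))
    · have hsub : {w : ℂ | 2 < ‖w‖} ⊆ (range f)ᶜ := fun w hw h =>
        absurd ((hmem w).1 h).2 (not_le.2 hw)
      exact Or.inr ((isPreconnected_setOf_lt_norm (E := ℂ) (by simp [Complex.rank_real_complex])
        (zero_le_two (α := ℝ))).subset_connectedComponentIn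
        (show (2 : ℝ) < ‖(3 : ℂ)‖ by norm_num) hsub hz)
  obtain ⟨U', hU', rfl⟩ := hemb.isOpen_iff.1 hU
  obtain ⟨V, hV, hCV, hVU⟩ := exists_isOpen_forall_subset_of_separating hK hcov'
    (fun D hD => by
      obtain ⟨γ, hγ, -, rfl⟩ := hcirc' D hD
      exact isConnected_range hγ)
    (fun D hD => by
      obtain ⟨γ, hγ, -, rfl⟩ := hcirc' D hD
      exact (isCompact_range hγ).isClosed)
    hdisj' h0 h3
    (fun D hD => notMem_connectedComponentIn_compl_of_partition hK hcov' hcirc' hdisj' h0 hKc hD)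
    (mem_image_of_mem _ hC) hU' (image_subset_iff.2 hCU)
  refine ⟨f ⁻¹' V, hV.preimage hf, image_subset_iff.1 hCV, fun D hD hDV => image_subset_iff.1 ?_⟩
  obtain ⟨p, hpD, hpV⟩ := nonempty_iff_ne_empty.2 hDV
  exact hVU _ (mem_image_of_mem _ hD) ⟨f p, mem_image_of_mem f hpD, hpV⟩
end

section
/- Let 𝒞 be a circle decomposition of the annulus A. Then there exists a continuous surjective map f : A → Set.Icc (0:ℝ) 1 which is a quotient map (IsQuotientMap) and whose fibers f ⁻¹' {t}, for t ∈ [0,1], are precisely the elements of 𝒞; in particular the quotient space of A by the decomposition 𝒞 is homeomorphic to [0,1]. -/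
open Topology Set

/-- The one-dimensional Borsuk-Ulam theorem. -/
lemma Circle.exists_eq_neg_of_continuous {f : Circle → ℝ} (hf : Continuous f) :
    ∃ u, f u = f (-u) := by
  obtain h | h := le_total (f 1) (f (-1))
  · obtain ⟨u, -, hu⟩ := isPreconnected_univ.intermediate_value₂ (mem_univ (1 : Circle))
      (mem_univ (-1)) hf.continuousOn (hf.comp continuous_neg).continuousOn h (by simpa using h)
    exact ⟨u, hu⟩
  · obtain ⟨u, -, hu⟩ := isPreconnected_univ.intermediate_value₂ (mem_univ (-1 : Circle))
      (mem_univ 1) hf.continuousOn (hf.comp continuous_neg).continuousOn (by simpa using h) h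
    exact ⟨u, hu⟩

lemma Circle.not_exists_continuous_log :
    ¬ ∃ L : Circle → ℂ, Continuous L ∧ ∀ u, Complex.exp (L u) = u := by
  rintro ⟨L, hL, hexp⟩
  obtain ⟨u, hu⟩ := Circle.exists_eq_neg_of_continuous (Complex.continuous_im.comp hL)
  have h : Complex.exp (((L u).re - (L (-u)).re : ℝ) : ℂ) = -1 := by
    have : (((L u).re - (L (-u)).re : ℝ) : ℂ) = L u - L (-u) := by
      apply Complex.ext
      · simp
      · simpa [sub_eq_zero, eq_comm] using hu
    rw [this, Complex.exp_sub, hexp, hexp]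
    simp
  have h' := congrArg Complex.re h
  rw [← Complex.ofReal_exp, Complex.ofReal_re] at h'
  have := Real.exp_pos ((L u).re - (L (-u)).re)
  simp at h'
  linarith

lemma not_exists_continuousOn_log_div {a b : ℂ} (hab : a ≠ b) :
    ¬ ∃ L : ℂ → ℂ, ContinuousOn L {a, b}ᶜ ∧
      ∀ z ∈ ({a, b} : Set ℂ)ᶜ, Complex.exp (L z) = (z - b) / (z - a) := by
  rintro ⟨L, hL, hexp⟩
  apply Circle.not_exists_continuous_log
  set c : ℂ := (a - b) / 2 with hc
  have hc0 : c ≠ 0 := div_ne_zero (sub_ne_zero.2 hab) two_ne_zero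
  have hr : (‖c‖ : ℂ) ≠ 0 := by simpa using hc0
  set p : Circle → ℂ := fun u ↦ ‖c‖ * u with hp
  have hpn : ∀ u, ‖p u‖ = ‖c‖ := fun u ↦ by
    simp only [hp, norm_mul, Circle.norm_coe, Complex.norm_real, norm_norm, mul_one]
  have hp0 : ∀ u, p u ≠ 0 := fun u ↦ by rw [← norm_ne_zero_iff, hpn]; simpa using hc0
  have hpc : Continuous p := by fun_prop
  have hb : ∀ u, 2 * c + p u ≠ 0 := by
    intro u h
    have h1 : p u = -(2 * c) := by linear_combination h
    have := hpn u
    rw [h1, norm_neg, norm_mul] at this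
    have h3 : 0 < ‖c‖ := norm_pos_iff.2 hc0
    simp at this
    linarith
  have hsl : ∀ u, 1 + p u / (2 * c) ∈ Complex.slitPlane := by
    intro u
    apply Complex.mem_slitPlane_of_norm_lt_one
    rw [norm_div, hpn, norm_mul]
    have h3 : 0 < ‖c‖ := norm_pos_iff.2 hc0
    rw [div_lt_one (by simpa using hc0)]
    simp
    linarith
  have hmem : ∀ u, a + p u ∈ ({a, b} : Set ℂ)ᶜ := by
    intro u
    simp only [mem_compl_iff, mem_insert_iff, mem_singleton_iff, add_eq_left, hp0, false_or]
    intro h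
    apply hb u
    rw [hc]
    linear_combination h
  refine ⟨fun u ↦ Complex.log (1 + p u / (2 * c)) + Complex.log (2 * c / ‖c‖) - L (a + p u),
    ?_, ?_⟩
  · refine Continuous.sub (Continuous.add (Continuous.clog (by fun_prop) hsl) continuous_const) ?_
    exact hL.comp_continuous (by fun_prop) hmem
  · intro u
    have h2 : (2 * c / ‖c‖ : ℂ) ≠ 0 := by simp [hc0]
    have h4 : a + p u - b = 2 * c + p u := by rw [hc]; ring
    rw [Complex.exp_sub, Complex.exp_add, Complex.exp_log (Complex.slitPlane_ne_zero (hsl u)),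
      Complex.exp_log h2, hexp _ (hmem u), h4]
    have h5 := hb u
    have h6 := hp0 u
    have h7 : (u : ℂ) = p u / ‖c‖ := by simp only [hp]; field_simp
    rw [h7]
    field_simp
    ring

/-- Off an arc from `a` to `b`, the function `(z - b) / (z - a)` has a continuous logarithm,
which is the principal one near infinity. -/
lemma Path.exists_continuousOn_log {a b : ℂ} (γ : Path a b) :
    ∃ L : ℂ → ℂ, ContinuousOn L (range γ)ᶜ ∧
      (∀ z ∈ (range γ)ᶜ, Complex.exp (L z) = (z - b) / (z - a)) ∧
      ∃ R : ℝ, ∀ z, R < ‖z‖ → z ∈ (range γ)ᶜ ∧ L z = Complex.log ((z - b) / (z - a)) := by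
  classical
  have hne : ∀ z ∈ (range γ)ᶜ, ∀ t, z - γ t ≠ 0 := fun z hz t h ↦
    hz ⟨t, (sub_eq_zero.1 h).symm⟩
  have hna : ∀ z ∈ (range γ)ᶜ, z - a ≠ 0 := fun z hz ↦ by simpa using hne z hz 0
  let H : C(unitInterval × ((range γ)ᶜ : Set ℂ), {z : ℂ // z ≠ 0}) :=
    ⟨fun p ↦ ⟨(p.2 - γ p.1) / (p.2 - a), div_ne_zero (hne _ p.2.2 _) (hna _ p.2.2)⟩,
      Continuous.subtype_mk (Continuous.div₀ (by fun_prop) (by fun_prop)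
        fun p ↦ hna _ p.2.2) _⟩
  have H0 : ∀ z, H (0, z) = (⟨_, Complex.exp_ne_zero ((0 : C(((range γ)ᶜ : Set ℂ), ℂ)) z)⟩ :
      {z : ℂ // z ≠ 0}) := by
    intro z
    apply Subtype.ext
    simp [H, div_self (hna _ z.2)]
  let G := Complex.isCoveringMap_exp.liftHomotopy H 0 H0
  have hG : ∀ t z, Complex.exp (G (t, z)) = (z - γ t) / (z - a) := fun t z ↦
    congrArg Subtype.val (congrFun (Complex.isCoveringMap_exp.liftHomotopy_lifts H 0 H0) (t, z))
  have hG0 : ∀ z, G (0, z) = 0 := fun z ↦ Complex.isCoveringMap_exp.liftHomotopy_zero H 0 H0 z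
  refine ⟨fun z ↦ if h : z ∈ (range γ)ᶜ then G (1, ⟨z, h⟩) else 0, ?_, ?_, ?_⟩
  · rw [continuousOn_iff_continuous_domRestrict]
    have : Continuous fun z : ((range γ)ᶜ : Set ℂ) ↦ G (1, z) := by fun_prop
    refine this.congr fun z ↦ ?_
    have h := z.2
    simp only [domRestrict_apply]
    rw [dif_pos h]
  · intro z hz
    simp only [dif_pos hz]
    simpa using hG 1 ⟨z, hz⟩
  · obtain ⟨R, hR0, hR⟩ := (isCompact_range γ.continuous).isBounded.exists_pos_norm_le
    have hRt : ∀ t, ‖γ t‖ ≤ R := fun t ↦ hR _ (mem_range_self t)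
    refine ⟨3 * R, fun z hz ↦ ?_⟩
    have hmem : z ∈ (range γ)ᶜ := by
      rintro ⟨t, rfl⟩
      have := hRt t
      linarith
    refine ⟨hmem, ?_⟩
    simp only [dif_pos hmem]
    have hsl : ∀ t, (z - γ t) / (z - a) ∈ Complex.slitPlane := by
      intro t
      have h1 : (z - γ t) / (z - a) = 1 + (a - γ t) / (z - a) := by
        field_simp [hna z hmem]
        ring
      rw [h1]
      apply Complex.mem_slitPlane_of_norm_lt_one
      rw [norm_div, div_lt_one (norm_pos_iff.2 (hna z hmem))]
      have h2 : ‖a‖ ≤ R := by simpa using hRt 0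
      have := norm_sub_le a (γ t)
      have := norm_sub_norm_le z a
      have := hRt t
      linarith
    have key := Complex.isCoveringMap_exp.eq_of_comp_eq (A := unitInterval)
      (g₁ := fun t ↦ G (t, ⟨z, hmem⟩)) (g₂ := fun t ↦ Complex.log ((z - γ t) / (z - a)))
      (by fun_prop) (Continuous.clog (by fun_prop) hsl)
      (by
        funext t
        apply Subtype.ext
        simp only [Function.comp_apply]
        rw [hG, Complex.exp_log (Complex.slitPlane_ne_zero (hsl t))])
      0 (by simp [hG0, div_self (hna z hmem)])
    simpa using congrFun key 1

/-- The separation half of the Jordan curve theorem. -/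
lemma IsCircle.not_isPreconnected_compl {C : Set ℂ} (hC : IsCircle C) : ¬ IsPreconnected Cᶜ := by
  classical
  obtain ⟨h⟩ := hC
  intro hpre
  let φ : Circle → ℂ := fun u ↦ h.symm u
  have hφ : Continuous φ := by fun_prop
  have hinj : Function.Injective φ := Subtype.val_injective.comp h.symm.injective
  have hrange : range φ = C := by
    rw [show φ = Subtype.val ∘ h.symm from rfl, h.symm.surjective.range_comp, Subtype.range_coe]
  have h1 : (1 : Circle) ≠ -1 := (Circle.neg_ne_self 1).symm
  let γ₁ : Path (φ 1) (φ (-1)) := (Circle.path 1 (-1)).map hφ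
  let γ₂ : Path (φ 1) (φ (-1)) := (Circle.path (-1) 1).symm.map hφ
  have hr₁ : range γ₁ = φ '' range (Circle.path 1 (-1)) := by
    rw [← range_comp]; rfl
  have hr₂ : range γ₂ = φ '' range (Circle.path (-1) 1) := by
    rw [← Path.symm_range (Circle.path (-1) 1), ← range_comp]; rfl
  have hunion : range γ₁ ∪ range γ₂ = C := by
    rw [hr₁, hr₂, ← image_union, Circle.range_path_union_range_path h1, image_univ, hrange]
  have hinter : range γ₁ ∩ range γ₂ = {φ 1, φ (-1)} := by
    rw [hr₁, hr₂, ← image_inter hinj, Circle.range_path_inter_range_path h1, image_pair]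
  obtain ⟨L₁, hc₁, he₁, R₁, hR₁⟩ := γ₁.exists_continuousOn_log
  obtain ⟨L₂, hc₂, he₂, R₂, hR₂⟩ := γ₂.exists_continuousOn_log
  have hs₁ : Cᶜ ⊆ (range γ₁)ᶜ := compl_subset_compl.2 (hunion ▸ subset_union_left)
  have hs₂ : Cᶜ ⊆ (range γ₂)ᶜ := compl_subset_compl.2 (hunion ▸ subset_union_right)
  obtain ⟨w, hw⟩ := NormedSpace.exists_lt_norm ℂ ℂ (max R₁ R₂)
  have hw₁ := hR₁ w ((le_max_left _ _).trans_lt hw)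
  have hw₂ := hR₂ w ((le_max_right _ _).trans_lt hw)
  have hwC : w ∈ Cᶜ := by
    rw [← hunion, compl_union]
    exact ⟨hw₁.1, hw₂.1⟩
  have heq : EqOn L₁ L₂ Cᶜ := by
    refine Complex.isCoveringMap_exp.eqOn_of_comp_eqOn hpre (hc₁.mono hs₁) (hc₂.mono hs₂) ?_ hwC
      (hw₁.2.trans hw₂.2.symm)
    intro z hz
    apply Subtype.ext
    simp only [Function.comp_apply]
    rw [he₁ z (hs₁ hz), he₂ z (hs₂ hz)]
  apply not_exists_continuousOn_log_div (hinj.ne h1)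
  have ho₁ : IsOpen (range γ₁)ᶜ := (isCompact_range γ₁.continuous).isClosed.isOpen_compl
  have ho₂ : IsOpen (range γ₂)ᶜ := (isCompact_range γ₂.continuous).isClosed.isOpen_compl
  set L : ℂ → ℂ := fun z ↦ if z ∈ range γ₁ then L₂ z else L₁ z with hL
  have hL₁ : EqOn L L₁ (range γ₁)ᶜ := fun z hz ↦ if_neg hz
  have hL₂ : EqOn L L₂ (range γ₂)ᶜ := by
    intro z hz
    by_cases hz₁ : z ∈ range γ₁
    · exact if_pos hz₁
    · rw [hL₁ hz₁]
      refine heq ?_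
      rw [← hunion, compl_union]
      exact ⟨hz₁, hz⟩
  have hcases : ∀ z ∈ ({φ 1, φ (-1)} : Set ℂ)ᶜ, z ∈ (range γ₁)ᶜ ∨ z ∈ (range γ₂)ᶜ := by
    intro z hz
    rw [← hinter, compl_inter] at hz
    exact hz
  refine ⟨L, fun z hz ↦ ?_, fun z hz ↦ ?_⟩
  · apply ContinuousAt.continuousWithinAt
    obtain hz | hz := hcases z hz
    · exact ((hc₁.congr hL₁).continuousAt (ho₁.mem_nhds hz))
    · exact ((hc₂.congr hL₂).continuousAt (ho₂.mem_nhds hz))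
  · obtain hz | hz := hcases z hz
    · rw [hL₁ hz, he₁ z hz]
    · rw [hL₂ hz, he₂ z hz]

section SeparatingPartition

variable {X : Type*} [TopologicalSpace X]

/-- A partition of a compact set `⋃₀ 𝒞` into connected closed sets which disconnect the ambient
space, the complement of `⋃₀ 𝒞` being the union of two preconnected sets, one containing `p` and
one containing `q`. -/
structure IsSeparatingPartition (𝒞 : Set (Set X)) (p q : X) : Prop where
  isClosed : ∀ C ∈ 𝒞, IsClosed C
  isConnected : ∀ C ∈ 𝒞, IsConnected C
  not_isPreconnected_compl : ∀ C ∈ 𝒞, ¬ IsPreconnected Cᶜ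
  disjoint : ∀ C ∈ 𝒞, ∀ D ∈ 𝒞, C ≠ D → Disjoint C D
  isCompact_sUnion : IsCompact (⋃₀ 𝒞)
  left_notMem : p ∉ ⋃₀ 𝒞
  right_notMem : q ∉ ⋃₀ 𝒞
  compl_sUnion_subset :
    (⋃₀ 𝒞)ᶜ ⊆ connectedComponentIn (⋃₀ 𝒞)ᶜ p ∪ connectedComponentIn (⋃₀ 𝒞)ᶜ q

namespace IsSeparatingPartition

variable {𝒞 : Set (Set X)} {p q : X} {C D : Set X}

lemma symm (h : IsSeparatingPartition 𝒞 p q) : IsSeparatingPartition 𝒞 q p where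
  __ := h
  left_notMem := h.right_notMem
  right_notMem := h.left_notMem
  compl_sUnion_subset := by
    rw [union_comm]
    exact h.compl_sUnion_subset

lemma left_notMem_of_mem (h : IsSeparatingPartition 𝒞 p q)
    (hC : C ∈ 𝒞) : p ∉ C := fun hp ↦ h.left_notMem ⟨C, hC, hp⟩

lemma right_notMem_of_mem (h : IsSeparatingPartition 𝒞 p q)
    (hC : C ∈ 𝒞) : q ∉ C := fun hq ↦ h.right_notMem ⟨C, hC, hq⟩

lemma exists_mem_of_notMem (h : IsSeparatingPartition 𝒞 p q)
    (hC : C ∈ 𝒞) {y : X} (hp : y ∉ connectedComponentIn Cᶜ p)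
    (hq : y ∉ connectedComponentIn Cᶜ q) : ∃ D ∈ 𝒞, y ∈ D := by
  by_contra hy
  have hsub : (⋃₀ 𝒞)ᶜ ⊆ Cᶜ := compl_subset_compl.2 (subset_sUnion_of_mem hC)
  obtain hy | hy := h.compl_sUnion_subset hy
  · exact hp (connectedComponentIn_mono p hsub hy)
  · exact hq (connectedComponentIn_mono q hsub hy)

lemma subset_component (h : IsSeparatingPartition 𝒞 p q)
    (hC : C ∈ 𝒞) (hD : D ∈ 𝒞) (hne : D ≠ C) {y : X} (hy : y ∈ D) :
    D ⊆ connectedComponentIn Cᶜ y :=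
  (h.isConnected D hD).isPreconnected.subset_connectedComponentIn hy
    (h.disjoint D hD C hC hne).subset_compl_right

lemma disjoint_component (h : IsSeparatingPartition 𝒞 p q)
    (hC : C ∈ 𝒞) (hD : D ∈ 𝒞) (hne : D ≠ C) {x y : X} (hy : y ∈ D)
    (hyx : y ∉ connectedComponentIn Cᶜ x) : Disjoint D (connectedComponentIn Cᶜ x) := by
  rw [disjoint_left]
  intro z hz hzx
  have := h.subset_component hC hD hne hz hy
  rw [← connectedComponentIn_eq hzx] at this
  exact hyx this

lemma component_subset_of_disjoint (h : IsSeparatingPartition 𝒞 p q) (hC : C ∈ 𝒞)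
    (hdisj : Disjoint D (connectedComponentIn Cᶜ q)) :
    connectedComponentIn Cᶜ q ⊆ connectedComponentIn Dᶜ q :=
  isPreconnected_connectedComponentIn.subset_connectedComponentIn
    (mem_connectedComponentIn (h.right_notMem_of_mem hC)) hdisj.subset_compl_left

end IsSeparatingPartition

variable [LocallyConnectedSpace X]

lemma IsSeparatingPartition.isOpen_component {𝒞 : Set (Set X)} {p q : X}
    (h : IsSeparatingPartition 𝒞 p q) {C : Set X} (hC : C ∈ 𝒞) (x : X) :
    IsOpen (connectedComponentIn Cᶜ x) :=
  (h.isClosed C hC).isOpen_compl.connectedComponentIn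

variable [PreconnectedSpace X]

lemma closure_connectedComponentIn_compl_inter_nonempty {C : Set X} (hC : IsClosed C)
    (hne : C.Nonempty) {x : X} (hx : x ∉ C) :
    (closure (connectedComponentIn Cᶜ x) ∩ C).Nonempty := by
  have hxK : x ∈ connectedComponentIn Cᶜ x := mem_connectedComponentIn hx
  have hKC := connectedComponentIn_subset Cᶜ x
  obtain ⟨z, hz⟩ := nonempty_frontier_iff.2 ⟨⟨x, hxK⟩, fun h ↦ by
    obtain ⟨c, hc⟩ := hne
    exact hKC (h ▸ mem_univ c) hc⟩
  refine ⟨z, frontier_subset_closure hz, ?_⟩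
  by_contra hzC
  have hzK : z ∈ connectedComponentIn Cᶜ z := mem_connectedComponentIn hzC
  obtain ⟨w, hwz, hwx⟩ := mem_closure_iff.1 (frontier_subset_closure hz) _
    (hC.isOpen_compl.connectedComponentIn (x := z)) hzK
  rw [connectedComponentIn_eq hwz, ← connectedComponentIn_eq hwx] at hzK
  have ho : IsOpen (connectedComponentIn Cᶜ x) := hC.isOpen_compl.connectedComponentIn
  exact (ho.frontier_eq ▸ hz).2 hzK

lemma isPreconnected_union_connectedComponentIn_compl_s9 {C : Set X} (hC : IsClosed C)
    (hconn : IsConnected C) {x : X} (hx : x ∉ C) :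
    IsPreconnected (C ∪ connectedComponentIn Cᶜ x) := by
  obtain ⟨z, hz, hzC⟩ := closure_connectedComponentIn_compl_inter_nonempty hC hconn.nonempty hx
  have h : IsPreconnected (insert z (connectedComponentIn Cᶜ x)) :=
    isPreconnected_connectedComponentIn.subset_closure (subset_insert _ _)
      (insert_subset hz subset_closure)
  have := IsPreconnected.union z hzC (mem_insert _ _) hconn.isPreconnected h
  rwa [union_insert, insert_eq_of_mem (mem_union_left _ hzC)] at this

namespace IsSeparatingPartition

variable {𝒞 : Set (Set X)} {p q : X} {C D : Set X}

/-- Every member of the partition separates `p` from `q`. -/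
lemma left_notMem_component (h : IsSeparatingPartition 𝒞 p q)
    (hC : C ∈ 𝒞) : p ∉ connectedComponentIn Cᶜ q := by
  intro hpC
  have key : ∀ D ∈ 𝒞, p ∈ connectedComponentIn Dᶜ q → ∀ E ∈ 𝒞, ∀ y ∈ E,
      y ∉ connectedComponentIn Dᶜ q →
      connectedComponentIn Dᶜ q ⊆ connectedComponentIn Eᶜ q := by
    intro D hD hpD E hE y hyE hyD
    obtain rfl | hne := eq_or_ne E D
    · exact Subset.rfl
    · exact h.component_subset_of_disjoint hD (h.disjoint_component hD hE hne hyE hyD)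
  have hsub : ∀ D ∈ 𝒞, p ∈ connectedComponentIn Dᶜ q →
      ∀ y ∉ connectedComponentIn Dᶜ q, ∃ E ∈ 𝒞, y ∈ E := by
    intro D hD hpD y hy
    refine h.exists_mem_of_notMem hD ?_ hy
    rwa [← connectedComponentIn_eq hpD]
  obtain ⟨M, -, hM⟩ := zorn_superset_nonempty
    {K : Set X | ∃ D ∈ 𝒞, p ∈ connectedComponentIn Dᶜ q ∧ K = (connectedComponentIn Dᶜ q)ᶜ}
    (by
      intro c hc hchain hcne
      have hcpt : ∀ K ∈ c, K.Nonempty ∧ IsCompact K ∧ IsClosed K := by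
        intro K hK
        obtain ⟨D, hD, hpD, rfl⟩ := hc hK
        have hcl : IsClosed (connectedComponentIn Dᶜ q)ᶜ := (h.isOpen_component hD q).isClosed_compl
        refine ⟨?_, ?_, hcl⟩
        · obtain ⟨d, hd⟩ := (h.isConnected D hD).nonempty
          exact ⟨d, fun hdq ↦ connectedComponentIn_subset _ _ hdq hd⟩
        · exact h.isCompact_sUnion.of_isClosed_subset hcl fun y hy ↦ hsub D hD hpD y hy
      obtain ⟨y, hy⟩ : (⋂₀ c).Nonempty := by
        have : Nonempty c := hcne.to_subtype
        refine IsCompact.nonempty_sInter_of_directed_nonempty_isCompact_isClosed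
          (fun a ha b hb ↦ (hchain.total ha hb).elim (fun hab ↦ ⟨a, ha, Subset.rfl, hab⟩)
            fun hba ↦ ⟨b, hb, hba, Subset.rfl⟩) (fun K hK ↦ (hcpt K hK).1)
          (fun K hK ↦ (hcpt K hK).2.1) (fun K hK ↦ (hcpt K hK).2.2)
      obtain ⟨K₀, hK₀⟩ := hcne
      obtain ⟨D₀, hD₀, hpD₀, rfl⟩ := hc hK₀
      obtain ⟨E, hE, hyE⟩ := hsub D₀ hD₀ hpD₀ y (hy _ hK₀)
      refine ⟨(connectedComponentIn Eᶜ q)ᶜ,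
        ⟨E, hE, key D₀ hD₀ hpD₀ E hE y hyE (hy _ hK₀) hpD₀, rfl⟩, fun K hK ↦ ?_⟩
      obtain ⟨D, hD, hpD, rfl⟩ := hc hK
      exact compl_subset_compl.2 (key D hD hpD E hE y hyE (hy _ hK)))
    _ ⟨C, hC, hpC, rfl⟩
  obtain ⟨D, hD, hpD, rfl⟩ := hM.prop
  obtain ⟨y, hyD, hyq⟩ : ∃ y, y ∉ D ∧ y ∉ connectedComponentIn Dᶜ q := by
    by_contra! hall
    apply h.not_isPreconnected_compl D hD
    have hsubset : Dᶜ ⊆ connectedComponentIn Dᶜ q := hall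
    rw [hsubset.antisymm (connectedComponentIn_subset Dᶜ q)]
    exact isPreconnected_connectedComponentIn
  obtain ⟨E, hE, hyE⟩ := hsub D hD hpD y hyq
  have hne : E ≠ D := by
    rintro rfl
    exact hyD hyE
  have hDE := key D hD hpD E hE y hyE hyq
  have hED : connectedComponentIn Eᶜ q ⊆ connectedComponentIn Dᶜ q :=
    compl_subset_compl.1 (hM.le_of_le ⟨E, hE, hDE hpD, rfl⟩ (compl_subset_compl.2 hDE))
  have heq := hED.antisymm hDE
  obtain ⟨z, hz, hzD⟩ := closure_connectedComponentIn_compl_inter_nonempty (h.isClosed D hD)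
    (h.isConnected D hD).nonempty (h.right_notMem_of_mem hD)
  have hzE : z ∉ E := (h.disjoint E hE D hD hne).notMem_of_mem_right hzD
  have hzq : z ∉ connectedComponentIn Eᶜ q := fun hzq ↦
    connectedComponentIn_subset _ _ (hED hzq) hzD
  rw [← heq] at hz
  obtain ⟨w, hwz, hwq⟩ := mem_closure_iff.1 hz _ (h.isOpen_component hE z)
    (mem_connectedComponentIn hzE)
  apply hzq
  rw [connectedComponentIn_eq hwq, ← connectedComponentIn_eq hwz]
  exact mem_connectedComponentIn hzE

lemma disjoint_components (h : IsSeparatingPartition 𝒞 p q) (hC : C ∈ 𝒞) :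
    Disjoint (connectedComponentIn Cᶜ p) (connectedComponentIn Cᶜ q) := by
  rw [disjoint_left]
  intro z hzp hzq
  apply h.left_notMem_component hC
  rw [connectedComponentIn_eq hzq, ← connectedComponentIn_eq hzp]
  exact mem_connectedComponentIn (h.left_notMem_of_mem hC)

lemma union_components (h : IsSeparatingPartition 𝒞 p q) (hC : C ∈ 𝒞) :
    connectedComponentIn Cᶜ p ∪ C ∪ connectedComponentIn Cᶜ q = univ := by
  rw [eq_univ_iff_forall]
  by_contra! hall
  obtain ⟨y, hy⟩ := hall
  simp only [mem_union, not_or] at hy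
  obtain ⟨⟨hyp, hyC⟩, hyq⟩ := hy
  obtain ⟨D, hD, hyD⟩ := h.exists_mem_of_notMem hC hyp hyq
  have hne : D ≠ C := by
    rintro rfl
    exact hyC hyD
  have hcp := isPreconnected_union_connectedComponentIn_compl_s9 (h.isClosed C hC)
    (h.isConnected C hC) (h.left_notMem_of_mem hC)
  have hcq := isPreconnected_union_connectedComponentIn_compl_s9 (h.isClosed C hC)
    (h.isConnected C hC) (h.right_notMem_of_mem hC)
  obtain ⟨c, hc⟩ := (h.isConnected C hC).nonempty
  have hconn := hcp.union c (mem_union_left _ hc) (mem_union_left _ hc) hcq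
  have hCD := (h.disjoint D hD C hC hne).subset_compl_left
  have hsub := hconn.subset_connectedComponentIn (F := Dᶜ) (x := q)
    (Or.inr (Or.inr (mem_connectedComponentIn (h.right_notMem_of_mem hC))))
    (union_subset (union_subset hCD (h.disjoint_component hC hD hne hyD hyp).subset_compl_left)
      (union_subset hCD (h.disjoint_component hC hD hne hyD hyq).subset_compl_left))
  exact h.left_notMem_component hD
    (hsub (Or.inl (Or.inr (mem_connectedComponentIn (h.left_notMem_of_mem hC)))))

lemma subset_component_or (h : IsSeparatingPartition 𝒞 p q)
    (hC : C ∈ 𝒞) (hD : D ∈ 𝒞) (hne : D ≠ C) :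
    D ⊆ connectedComponentIn Cᶜ p ∨ D ⊆ connectedComponentIn Cᶜ q := by
  refine (h.isConnected D hD).isPreconnected.subset_or_subset (h.isOpen_component hC p)
    (h.isOpen_component hC q) (h.disjoint_components hC) fun z hz ↦ ?_
  have hzC : z ∉ C := (h.disjoint D hD C hC hne).notMem_of_mem_left hz
  have := h.union_components hC ▸ mem_univ z
  simp only [mem_union, hzC, or_false] at this
  exact this

lemma union_subset_component (h : IsSeparatingPartition 𝒞 p q) (hC : C ∈ 𝒞)
    (hDC : D ⊆ connectedComponentIn Cᶜ p) :
    C ∪ connectedComponentIn Cᶜ q ⊆ connectedComponentIn Dᶜ q := by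
  refine (isPreconnected_union_connectedComponentIn_compl_s9 (h.isClosed C hC)
    (h.isConnected C hC) (h.right_notMem_of_mem hC)).subset_connectedComponentIn
    (Or.inr (mem_connectedComponentIn (h.right_notMem_of_mem hC))) ?_
  refine union_subset (fun z hz hzD ↦ connectedComponentIn_subset _ _ (hDC hzD) hz) fun z hz hzD ↦ ?_
  exact (disjoint_left.1 (h.disjoint_components hC)) (hDC hzD) hz

lemma component_left_mono (h : IsSeparatingPartition 𝒞 p q)
    (hC : C ∈ 𝒞) (hD : D ∈ 𝒞) (hDC : D ⊆ connectedComponentIn Cᶜ p) :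
    connectedComponentIn Dᶜ p ⊆ connectedComponentIn Cᶜ p := by
  intro z hz
  have hzC : z ∉ C ∪ connectedComponentIn Cᶜ q := fun hzC ↦
    disjoint_left.1 (h.disjoint_components hD) hz (h.union_subset_component hC hDC hzC)
  have := h.union_components hC ▸ mem_univ z
  rw [union_assoc] at this
  exact this.resolve_right hzC

lemma ssubset_component_iff (h : IsSeparatingPartition 𝒞 p q)
    (hC : C ∈ 𝒞) (hD : D ∈ 𝒞) {x : X} (hx : x ∈ C) :
    connectedComponentIn Cᶜ p ⊂ connectedComponentIn Dᶜ p ↔ x ∈ connectedComponentIn Dᶜ p := by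
  have hxC : x ∉ connectedComponentIn Cᶜ p := fun h' ↦ connectedComponentIn_subset _ _ h' hx
  constructor
  · intro hlt
    have hne : C ≠ D := by
      rintro rfl
      exact hlt.ne rfl
    refine (h.subset_component_or hD hC hne).elim (fun h' ↦ h' hx) fun h' ↦ ?_
    exact (hlt.2 (subset_union_right.trans (h.symm.union_subset_component hD h'))).elim
  · intro hxD
    have hne : C ≠ D := by
      rintro rfl
      exact hxC hxD
    have hCD := (h.subset_component_or hD hC hne).resolve_right fun h' ↦
      disjoint_left.1 (h.disjoint_components hD) hxD (h' hx)
    exact ⟨h.component_left_mono hD hC hCD, fun h' ↦ hxC (h' hxD)⟩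

lemma ssubset_component_or (h : IsSeparatingPartition 𝒞 p q)
    (hC : C ∈ 𝒞) (hD : D ∈ 𝒞) (hne : D ≠ C) :
    connectedComponentIn Cᶜ p ⊂ connectedComponentIn Dᶜ p ∨
      connectedComponentIn Dᶜ p ⊂ connectedComponentIn Cᶜ p := by
  obtain ⟨x, hx⟩ := (h.isConnected C hC).nonempty
  obtain ⟨y, hy⟩ := (h.isConnected D hD).nonempty
  rw [h.ssubset_component_iff hC hD hx, h.ssubset_component_iff hD hC hy]
  refine (h.subset_component_or hC hD hne).elim (fun h' ↦ Or.inr (h' hy)) fun h' ↦ ?_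
  exact Or.inl (h.symm.union_subset_component hC h' (Or.inl hx))

lemma ssubset_component_iff' (h : IsSeparatingPartition 𝒞 p q)
    (hC : C ∈ 𝒞) (hD : D ∈ 𝒞) {x : X} (hx : x ∈ D) :
    connectedComponentIn Cᶜ p ⊂ connectedComponentIn Dᶜ p ↔ x ∈ connectedComponentIn Cᶜ q := by
  obtain ⟨y, hy⟩ := (h.isConnected C hC).nonempty
  constructor
  · intro hlt
    have hne : C ≠ D := by
      rintro rfl
      exact hlt.ne rfl
    refine (h.subset_component_or hC hD hne.symm).elim (fun h' ↦ ?_) fun h' ↦ h' hx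
    exact (hlt.2 (h.component_left_mono hC hD h')).elim
  · intro hxq
    have hne : D ≠ C := by
      rintro rfl
      exact connectedComponentIn_subset _ _ hxq hx
    rw [h.ssubset_component_iff hC hD hy]
    refine (h.subset_component_or hC hD hne).elim (fun h' ↦ ?_) fun h' ↦ ?_
    · exact (disjoint_left.1 (h.disjoint_components hC) (h' hx) hxq).elim
    · exact h.symm.union_subset_component hC h' (Or.inl hy)

/-- The members of the partition, ordered by the components of `p` in their complements. -/
noncomputable abbrev linearOrder (h : IsSeparatingPartition 𝒞 p q) : LinearOrder 𝒞 where
  __ := PartialOrder.lift (fun C : 𝒞 ↦ connectedComponentIn (C : Set X)ᶜ p) fun C D heq ↦ by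
    by_contra hne
    obtain h' | h' := h.ssubset_component_or D.2 C.2 fun h' ↦ hne (Subtype.ext h')
    · exact h'.ne heq.symm
    · exact h'.ne heq
  le_total C D := by
    obtain rfl | hne := eq_or_ne C D
    · exact Or.inl Subset.rfl
    · exact (h.ssubset_component_or D.2 C.2 fun h' ↦ hne (Subtype.ext h')).symm.imp
        (fun h' ↦ h'.subset) fun h' ↦ h'.subset
  toDecidableLE := Classical.decRel _

end IsSeparatingPartition

end SeparatingPartition

open TopologicalSpace in
/-- A surjection from a separable connected compact space onto a linear order, for which initial
and final open intervals have open preimages, identifies the linear order with `[0, 1]`. -/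
lemma exists_strictMono_continuous_comp {X L : Type*} [TopologicalSpace X] [PreconnectedSpace X]
    [CompactSpace X] [SeparableSpace X] [LinearOrder L] [Nontrivial L] {q : X → L}
    (hq : Function.Surjective q) (hlt : ∀ c, IsOpen {x | q x < c})
    (hgt : ∀ c, IsOpen {x | c < q x}) :
    ∃ F : L → Icc (0 : ℝ) 1, StrictMono F ∧ Continuous (F ∘ q) ∧ Function.Surjective (F ∘ q) := by
  obtain ⟨s, hs, hsd⟩ := exists_countable_dense X
  have hbtw : ∀ a b : L, a < b → ∃ c ∈ q '' s, a < c ∧ c < b := by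
    intro a b hab
    obtain ⟨x, rfl⟩ := hq a
    obtain ⟨y, rfl⟩ := hq b
    obtain ⟨z, hz⟩ := nonempty_inter (hgt (q x)) (hlt (q y))
      (eq_univ_of_forall fun z ↦ (lt_or_ge (q x) (q z)).imp id fun hz ↦ hz.trans_lt hab)
      ⟨y, hab⟩ ⟨x, hab⟩
    obtain ⟨w, ⟨hw₁, hw₂⟩, hws⟩ := hsd.inter_open_nonempty _ ((hgt (q x)).inter (hlt (q y))) ⟨z, hz⟩
    exact ⟨q w, mem_image_of_mem q hws, hw₁, hw₂⟩
  let D : Set L := {d ∈ q '' s | ¬ IsMin d ∧ ¬ IsMax d}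
  have hD : ∀ a b : L, a < b → ∃ d : D, a < d ∧ d < b := by
    intro a b hab
    obtain ⟨c, hc, hac, hcb⟩ := hbtw a b hab
    exact ⟨⟨c, hc, hac.not_isMin, hcb.not_isMax⟩, hac, hcb⟩
  have : Countable D := ((hs.image q).mono (sep_subset _ _)).to_subtype
  have : DenselyOrdered D := ⟨fun a b hab ↦ hD a b hab⟩
  have : NoMinOrder D := ⟨fun a ↦ by
    obtain ⟨b, hb⟩ := not_isMin_iff.1 a.2.2.1
    obtain ⟨d, -, hd⟩ := hD b a hb
    exact ⟨d, hd⟩⟩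
  have : NoMaxOrder D := ⟨fun a ↦ by
    obtain ⟨b, hb⟩ := not_isMax_iff.1 a.2.2.2
    obtain ⟨d, hd, -⟩ := hD a b hb
    exact ⟨d, hd⟩⟩
  have : Nonempty D := by
    obtain ⟨a, b, hab⟩ := exists_pair_lt L
    obtain ⟨d, -⟩ := hD a b hab
    exact ⟨d⟩
  have : Nonempty (Ioo (0 : ℚ) 1) := ⟨⟨1 / 2, by norm_num, by norm_num⟩⟩
  obtain ⟨φ⟩ := Order.iso_of_countable_dense D (Ioo (0 : ℚ) 1)
  let ψ : D → Icc (0 : ℝ) 1 := fun d ↦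
    ⟨((φ d : ℚ) : ℝ), by exact_mod_cast (φ d).2.1.le, by exact_mod_cast (φ d).2.2.le⟩
  have hψ : StrictMono ψ := fun a b hab ↦ by
    have : (φ a : ℚ) < φ b := φ.strictMono hab
    exact Subtype.mk_lt_mk.2 (by exact_mod_cast this)
  let F : L → Icc (0 : ℝ) 1 := fun c ↦ ⨆ d : {d : D // (d : L) ≤ c}, ψ d
  have hFD : ∀ d : D, F d = ψ d := fun d ↦
    le_antisymm (iSup_le fun e ↦ hψ.monotone e.2)
      (le_iSup (fun e : {e : D // (e : L) ≤ d} ↦ ψ e) ⟨d, le_rfl⟩)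
  have hmono : Monotone F := fun a b hab ↦ iSup_le fun e ↦
    le_iSup (fun e : {e : D // (e : L) ≤ b} ↦ ψ e) ⟨e, e.2.trans hab⟩
  have hstrict : StrictMono F := by
    intro a b hab
    obtain ⟨d, had, hdb⟩ := hD a b hab
    obtain ⟨e, hde, heb⟩ := hD d b hdb
    calc F a ≤ F d := hmono had.le
      _ = ψ d := hFD d
      _ < ψ e := hψ hde
      _ = F e := (hFD e).symm
      _ ≤ F b := hmono heb.le
  have hdense : DenseRange F := by
    refine dense_of_exists_between fun {a b} hab ↦ ?_
    obtain ⟨r, har, hrb⟩ := exists_rat_btwn (Subtype.coe_lt_coe.2 hab)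
    have hr : r ∈ Ioo (0 : ℚ) 1 :=
      ⟨by exact_mod_cast a.2.1.trans_lt har, by exact_mod_cast hrb.trans_le b.2.2⟩
    refine ⟨ψ (φ.symm ⟨r, hr⟩), ⟨_, hFD _⟩, ?_, ?_⟩
    · rw [← Subtype.coe_lt_coe]
      simpa [ψ] using har
    · rw [← Subtype.coe_lt_coe]
      simpa [ψ] using hrb
  let : TopologicalSpace L := Preorder.topology L
  have : OrderTopology L := ⟨rfl⟩
  have hqc : Continuous q := by
    refine continuous_generateFrom_iff.2 ?_
    rintro _ ⟨c, rfl | rfl⟩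
    · exact hgt c
    · exact hlt c
  have hc : Continuous (F ∘ q) := (hmono.continuous_of_denseRange hdense).comp hqc
  refine ⟨F, hstrict, hc, range_eq_univ.1 ?_⟩
  rw [← (isCompact_range hc).isClosed.closure_eq, hq.range_comp]
  exact hdense.closure_range

lemma IsCircle.isCompact {X : Type*} [TopologicalSpace X] {C : Set X} (hC : IsCircle C) :
    IsCompact C := by
  obtain ⟨h⟩ := hC
  have := h.symm.compactSpace
  exact isCompact_iff_compactSpace.2 this

lemma IsCircle.isConnected {X : Type*} [TopologicalSpace X] {C : Set X} (hC : IsCircle C) :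
    IsConnected C := by
  obtain ⟨h⟩ := hC
  exact isConnected_iff_connectedSpace.2 (h.symm.surjective.connectedSpace h.symm.continuous)

lemma IsCircle.image {X Y : Type*} [TopologicalSpace X] [TopologicalSpace Y] {C : Set X}
    (hC : IsCircle C) {e : X → Y} (he : IsEmbedding e) : IsCircle (e '' C) := by
  obtain ⟨h⟩ := hC
  exact ⟨(he.homeomorphImage C).symm.trans h⟩

/-- No continuous injection of the circle into itself misses a point. -/
lemma Circle.not_injective_of_notMem_range {g : Circle → Circle} (hg : Continuous g)
    {v : Circle} (hv : v ∉ range g) : ¬ Function.Injective g := by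
  intro hinj
  have hsl : ∀ u, ((-v⁻¹ * g u : Circle) : ℂ) ∈ Complex.slitPlane := by
    intro u
    rw [Complex.mem_slitPlane_iff_arg]
    refine ⟨fun harg ↦ hv ⟨u, ?_⟩, Circle.coe_ne_zero _⟩
    have h1 : -v⁻¹ * g u = -1 := by
      rw [← Circle.arg_eq_arg, harg]
      simp
    have h2 : v⁻¹ * g u = 1 := by simpa using h1
    rwa [inv_mul_eq_one, eq_comm] at h2
  obtain ⟨u, hu⟩ := Circle.exists_eq_neg_of_continuous
    (f := fun u ↦ ((-v⁻¹ * g u : Circle) : ℂ).arg)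
    (continuous_iff_continuousAt.2 fun u ↦ ContinuousAt.comp (g := Complex.arg)
      (f := fun u ↦ ((-v⁻¹ * g u : Circle) : ℂ)) (Complex.continuousAt_arg (hsl u))
      (by fun_prop))
  exact Circle.neg_ne_self u (hinj (mul_left_cancel (Circle.arg_eq_arg.1 hu))).symm

lemma not_isCircle_univ_annulus :
    ¬ IsCircle (univ : Set (Circle × Icc (0 : ℝ) 1)) := by
  rintro ⟨h⟩
  let k : Circle × Icc (0 : ℝ) 1 → Circle := fun x ↦ h ⟨x, mem_univ x⟩
  have hk : Continuous k := by fun_prop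
  have hinj : Function.Injective k := fun x y hxy ↦ congrArg Subtype.val (h.injective hxy)
  refine Circle.not_injective_of_notMem_range (g := fun u ↦ k (u, 0)) (v := k (1, 1))
    (by fun_prop) ?_ fun u v huv ↦ (Prod.ext_iff.1 (hinj huv)).1
  rintro ⟨u, hu⟩
  exact zero_ne_one (Prod.ext_iff.1 (hinj hu)).2

/-- The embedding of the annulus into the complex plane with image `1 ≤ ‖z‖ ≤ 2`. -/
def annulusToComplex (x : Circle × Icc (0 : ℝ) 1) : ℂ := ((1 + x.2 : ℝ) : ℂ) * x.1

lemma norm_annulusToComplex (x : Circle × Icc (0 : ℝ) 1) :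
    ‖annulusToComplex x‖ = 1 + x.2 := by
  rw [annulusToComplex, norm_mul, Circle.norm_coe, mul_one, Complex.norm_real, Real.norm_eq_abs,
    abs_of_nonneg (add_nonneg zero_le_one x.2.2.1)]

lemma continuous_annulusToComplex : Continuous annulusToComplex := by
  unfold annulusToComplex
  fun_prop

lemma isEmbedding_annulusToComplex : IsEmbedding annulusToComplex := by
  refine (continuous_annulusToComplex.isClosedEmbedding fun x y hxy ↦ ?_).isEmbedding
  have h2 : x.2 = y.2 := by
    have := congrArg norm hxy
    rw [norm_annulusToComplex, norm_annulusToComplex, add_right_inj] at this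
    exact Subtype.ext this
  refine Prod.ext (Circle.ext ?_) h2
  have hne : ((1 + y.2 : ℝ) : ℂ) ≠ 0 := by
    rw [Complex.ofReal_ne_zero]
    linarith [y.2.2.1]
  rw [annulusToComplex, annulusToComplex, h2] at hxy
  exact mul_left_cancel₀ hne hxy

lemma range_annulusToComplex : range annulusToComplex = {z : ℂ | 1 ≤ ‖z‖ ∧ ‖z‖ ≤ 2} := by
  ext z
  constructor
  · rintro ⟨x, rfl⟩
    rw [mem_ofPred_eq, norm_annulusToComplex]
    constructor <;> linarith [x.2.2.1, x.2.2.2]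
  · rintro ⟨h1, h2⟩
    refine ⟨(Circle.exp z.arg, ⟨‖z‖ - 1, by linarith, by linarith⟩), ?_⟩
    rw [annulusToComplex, Circle.coe_exp, add_sub_cancel, Complex.norm_mul_exp_arg_mul_I]

lemma isPreconnected_setOf_lt_norm_s9 {r : ℝ} (hr : 0 ≤ r) :
    IsPreconnected {z : ℂ | r < ‖z‖} := by
  have h : {z : ℂ | r < ‖z‖} =
      (fun x : Circle × ℝ ↦ (x.2 : ℂ) * x.1) '' (univ ×ˢ Ioi r) := by
    ext z
    constructor
    · intro hz
      refine ⟨(Circle.exp z.arg, ‖z‖), ⟨mem_univ _, hz⟩, ?_⟩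
      simp only [Circle.coe_exp, Complex.norm_mul_exp_arg_mul_I]
    · rintro ⟨⟨u, s⟩, ⟨-, hs⟩, rfl⟩
      have hs' : r < s := hs
      change r < ‖(s : ℂ) * u‖
      rwa [norm_mul, Circle.norm_coe, mul_one, Complex.norm_real, Real.norm_eq_abs,
        abs_of_pos (hr.trans_lt hs')]
  rw [h]
  exact (isPreconnected_univ.prod isPreconnected_Ioi).image _ (by fun_prop)

lemma IsCircleDecomposition.isSeparatingPartition {𝒞 : Set (Set (Circle × Icc (0 : ℝ) 1))}
    (h : IsCircleDecomposition 𝒞) :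
    IsSeparatingPartition (image annulusToComplex '' 𝒞) 0 3 := by
  have hcirc : ∀ C ∈ image annulusToComplex '' 𝒞, IsCircle C := by
    rintro _ ⟨C, hC, rfl⟩
    exact (h.1 C hC).image isEmbedding_annulusToComplex
  have hU : ⋃₀ (image annulusToComplex '' 𝒞) = {z : ℂ | 1 ≤ ‖z‖ ∧ ‖z‖ ≤ 2} := by
    rw [← image_sUnion, h.2.2, image_univ, range_annulusToComplex]
  have h0 : (0 : ℂ) ∉ ⋃₀ (image annulusToComplex '' 𝒞) := by
    rw [hU]
    norm_num
  have h3 : (3 : ℂ) ∉ ⋃₀ (image annulusToComplex '' 𝒞) := by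
    rw [hU]
    norm_num
  refine ⟨fun C hC ↦ (hcirc C hC).isCompact.isClosed, fun C hC ↦ (hcirc C hC).isConnected,
    fun C hC ↦ (hcirc C hC).not_isPreconnected_compl, ?_, ?_, h0, h3, ?_⟩
  · rintro _ ⟨C, hC, rfl⟩ _ ⟨D, hD, rfl⟩ hne
    exact disjoint_image_of_injective isEmbedding_annulusToComplex.injective
      (h.2.1 C hC D hD fun h' ↦ hne (h' ▸ rfl))
  · rw [hU, ← range_annulusToComplex]
    exact isCompact_range continuous_annulusToComplex
  · rw [hU]
    intro z hz
    rw [mem_compl_iff, mem_ofPred_eq, not_and_or, not_le, not_le] at hz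
    refine hz.imp (fun hz ↦ ?_) fun hz ↦ ?_
    · have hsub : Metric.ball (0 : ℂ) 1 ⊆ {z : ℂ | 1 ≤ ‖z‖ ∧ ‖z‖ ≤ 2}ᶜ := fun w hw hw' ↦
        (mem_ball_zero_iff.1 hw).not_ge hw'.1
      exact (convex_ball (0 : ℂ) 1).isPreconnected.subset_connectedComponentIn
        (by simp) hsub (by simpa using hz)
    · have hsub : {z : ℂ | 2 < ‖z‖} ⊆ {z : ℂ | 1 ≤ ‖z‖ ∧ ‖z‖ ≤ 2}ᶜ := fun w hw hw' ↦
        lt_irrefl _ (lt_of_lt_of_le hw hw'.2)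
      exact (isPreconnected_setOf_lt_norm_s9 zero_le_two).subset_connectedComponentIn
        (by norm_num) hsub hz

/-- For any circle decomposition `𝒞` of the annulus `A = Circle × [0,1]` there is a
continuous surjective quotient map `f : A → [0,1]` whose fibers are precisely the
elements of `𝒞`; in particular the decomposition space of `𝒞` is homeomorphic to `[0,1]`. -/
theorem circle_decomposition_annulus_quotient_interval
    (𝒞 : Set (Set (Circle × Set.Icc (0:ℝ) 1))) (h𝒞 : IsCircleDecomposition 𝒞) :
    ∃ f : Circle × Set.Icc (0:ℝ) 1 → Set.Icc (0:ℝ) 1,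
      Continuous f ∧ Function.Surjective f ∧ Topology.IsQuotientMap f ∧
      {s : Set (Circle × Set.Icc (0:ℝ) 1) | ∃ t : Set.Icc (0:ℝ) 1, s = f ⁻¹' {t}} = 𝒞 := by
  have h := h𝒞.isSeparatingPartition
  have hinj := isEmbedding_annulusToComplex.injective
  have hex : ∀ x, ∃ D : image annulusToComplex '' 𝒞, annulusToComplex x ∈ (D : Set ℂ) := by
    intro x
    obtain ⟨C, hC, hx⟩ := h𝒞.2.2 ▸ mem_univ x
    exact ⟨⟨_, C, hC, rfl⟩, mem_image_of_mem _ hx⟩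
  choose q hq using hex
  have hq_eq : ∀ x (D : image annulusToComplex '' 𝒞), annulusToComplex x ∈ (D : Set ℂ) →
      q x = D := by
    intro x D hx
    by_contra hne
    exact disjoint_left.1 (h.disjoint _ (q x).2 _ D.2 fun h' ↦ hne (Subtype.ext h')) (hq x) hx
  have hqs : Function.Surjective q := by
    intro D
    obtain ⟨C, hC, hCD⟩ := D.2
    obtain ⟨x, hx⟩ := (h𝒞.1 C hC).isConnected.nonempty
    exact ⟨x, hq_eq x D (hCD ▸ mem_image_of_mem _ hx)⟩
  have hnt : Nontrivial (image annulusToComplex '' 𝒞) := by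
    by_contra hnt
    rw [not_nontrivial_iff_subsingleton] at hnt
    obtain ⟨C, hC, -⟩ := h𝒞.2.2 ▸ mem_univ ((1, 0) : Circle × Icc (0 : ℝ) 1)
    apply not_isCircle_univ_annulus
    convert h𝒞.1 C hC
    refine (eq_univ_of_forall fun x ↦ ?_).symm
    have hx := hq x
    rw [Subsingleton.elim (q x) ⟨_, C, hC, rfl⟩] at hx
    exact hinj.mem_set_image.1 hx
  let := h.linearOrder
  obtain ⟨F, hF, hc, hs⟩ := exists_strictMono_continuous_comp hqs
    (fun D ↦ by
      convert (h.isOpen_component D.2 0).preimage continuous_annulusToComplex using 1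
      ext x
      exact h.ssubset_component_iff (q x).2 D.2 (hq x))
    (fun D ↦ by
      convert (h.isOpen_component D.2 3).preimage continuous_annulusToComplex using 1
      ext x
      exact h.ssubset_component_iff' D.2 (q x).2 (hq x))
  have hfib : ∀ C (hC : C ∈ 𝒞), (F ∘ q) ⁻¹' {F ⟨_, C, hC, rfl⟩} = C := by
    intro C hC
    ext x
    simp only [mem_preimage, Function.comp_apply, mem_singleton_iff, hF.injective.eq_iff]
    constructor
    · intro hx
      have := hq x
      rw [hx] at this
      exact hinj.mem_set_image.1 this
    · intro hx
      exact hq_eq x _ (mem_image_of_mem _ hx)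
  refine ⟨F ∘ q, hc, hs, IsQuotientMap.of_surjective_continuous hs hc, ?_⟩
  ext s
  constructor
  · rintro ⟨t, rfl⟩
    obtain ⟨x, rfl⟩ := hs t
    obtain ⟨C, hC, hCx⟩ := (q x).2
    rw [Function.comp_apply, show q x = ⟨_, C, hC, rfl⟩ from Subtype.ext hCx.symm, hfib C hC]
    exact hC
  · intro hs
    exact ⟨_, (hfib s hs).symm⟩
end
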